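/- Let ℋ be a positive real-analytic function on an open neighborhood O of p₀ = (x₀,y₀,z₀) in ℝ³ that is rotationally symmetric around the vertical line through p₀, i.e., ℋ(R_θ(p)) = ℋ(p) for all p ∈ O and all θ, where R_θ(p) = p₀ + ρ_θ(p − p₀) and ρ_θ(x,y,z) = (x cos θ − y sin θ, x sin θ + y cos θ, z). Let z ∈ A₁ (an elliptic solution of the prescribed mean curvature equation for ℋ on a punctured disk Ω centered at (x₀,y₀), extending continuously with z(x₀,y₀) = z₀, with nonvanishing Hessian determinant near (x₀,y₀)), and suppose z corresponds to A ∈ A₂ in the sense that some conformal parametrization ψ of the graph of z near the singularity extends real-analytically across v = 0 with ψ(u,0) = p₀ and ∂_vψ(u,0) = A(u)(cos u, −sin u, 1). Then z is radially symmetric near the singularity (i.e., on some punctured neighborhood of (x₀,y₀), z(x,y) depends only on (x−x₀)² + (y−y₀)²) if and only if A is a constant function. -/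

import Mathlib

noncomputable section

open Real Set Metric Filter MeasureTheory

/-- Points of Minkowski 3-space, as nested pairs. -/
abbrev R3 : Type := ℝ × ℝ × ℝ

/-- The Lorentzian inner product `⟨a,b⟩_L = a₁b₁ + a₂b₂ − a₃b₃` of Minkowski 3-space. -/
def lor (a b : R3) : ℝ := a.1 * b.1 + a.2.1 * b.2.1 - a.2.2 * b.2.2

/-- The Lorentzian cross product
`a ×_L b = (a₃b₂ − a₂b₃, a₁b₃ − a₃b₁, a₁b₂ − a₂b₁)`. -/
def lcross (a b : R3) : R3 :=
  (a.2.2 * b.2.1 - a.2.1 * b.2.2, a.1 * b.2.2 - a.2.2 * b.1, a.1 * b.2.1 - a.2.1 * b.1)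

/-- Partial derivative with respect to the first variable. -/
def pd1 {E : Type*} [NormedAddCommGroup E] [NormedSpace ℝ E]
    (f : ℝ × ℝ → E) (p : ℝ × ℝ) : E := fderiv ℝ f p (1, 0)

/-- Partial derivative with respect to the second variable. -/
def pd2 {E : Type*} [NormedAddCommGroup E] [NormedSpace ℝ E]
    (f : ℝ × ℝ → E) (p : ℝ × ℝ) : E := fderiv ℝ f p (0, 1)

def zx (z : ℝ × ℝ → ℝ) : ℝ × ℝ → ℝ := pd1 z
def zy (z : ℝ × ℝ → ℝ) : ℝ × ℝ → ℝ := pd2 z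
def zxx (z : ℝ × ℝ → ℝ) : ℝ × ℝ → ℝ := pd1 (zx z)
def zxy (z : ℝ × ℝ → ℝ) : ℝ × ℝ → ℝ := pd2 (zx z)
def zyy (z : ℝ × ℝ → ℝ) : ℝ × ℝ → ℝ := pd2 (zy z)

/-- Hessian determinant `z_xx z_yy − z_xy²`. -/
def hessDet (z : ℝ × ℝ → ℝ) (p : ℝ × ℝ) : ℝ := zxx z p * zyy z p - (zxy z p) ^ 2

/-- The punctured disk `{(x,y) : 0 < (x−x₀)² + (y−y₀)² < ρ²}`. -/
def PDisk (x₀ y₀ ρ : ℝ) : Set (ℝ × ℝ) :=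
  {p | 0 < (p.1 - x₀) ^ 2 + (p.2 - y₀) ^ 2 ∧ (p.1 - x₀) ^ 2 + (p.2 - y₀) ^ 2 < ρ ^ 2}

/-- `z` is an elliptic solution of the prescribed mean curvature equation for `H` on `U`,
with graph contained in `O`. -/
def IsEllSol (H : R3 → ℝ) (O : Set R3) (U : Set (ℝ × ℝ)) (z : ℝ × ℝ → ℝ) : Prop :=
  ContDiffOn ℝ 2 z U ∧
  (∀ p ∈ U, ((p.1, p.2, z p) : R3) ∈ O) ∧
  (∀ p ∈ U, (zx z p) ^ 2 + (zy z p) ^ 2 < 1) ∧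
  (∀ p ∈ U,
    (1 - (zy z p) ^ 2) * zxx z p + 2 * zx z p * zy z p * zxy z p
        + (1 - (zx z p) ^ 2) * zyy z p
      = 2 * H (p.1, p.2, z p) * (1 - (zx z p) ^ 2 - (zy z p) ^ 2) ^ ((3 : ℝ) / 2))

/-- The isolated singularity of `z` at `(x₀,y₀)` is removable: some `C²` function on a full
disk centered at `(x₀,y₀)` agrees with `z` on a punctured neighborhood. -/
def RemovableSing (x₀ y₀ : ℝ) (z : ℝ × ℝ → ℝ) : Prop :=
  ∃ ε > 0, ∃ Z : ℝ × ℝ → ℝ,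
    ContDiffOn ℝ 2 Z (ball ((x₀, y₀) : ℝ × ℝ) ε) ∧
    ∀ p ∈ ball ((x₀, y₀) : ℝ × ℝ) ε, p ≠ (x₀, y₀) → Z p = z p

/-- `H` is of class `C^{k,α}` on `O`: it is `C^k` and its `k`-th derivative is locally
`α`-Hölder on `O`. -/
def IsCkalpha (k : ℕ) (α : NNReal) (H : R3 → ℝ) (O : Set R3) : Prop :=
  ContDiffOn ℝ k H O ∧
  ∀ p ∈ O, ∃ ε > 0, ∃ C : NNReal,
    HolderOnWith C α (iteratedFDeriv ℝ k H) (ball p ε ∩ O)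

/-- The open strip `ℝ × (0,R)`. -/
def Strip (R : ℝ) : Set (ℝ × ℝ) := {p | 0 < p.2 ∧ p.2 < R}

/-- The open strip `ℝ × (−R,R)`. -/
def Strip2 (R : ℝ) : Set (ℝ × ℝ) := {p | -R < p.2 ∧ p.2 < R}

/-- The half-open strip `ℝ × [0,R)`. -/
def StripCl (R : ℝ) : Set (ℝ × ℝ) := {p | 0 ≤ p.2 ∧ p.2 < R}

/-- First two components of `ψ`: the planar projection `Π = (ψ₁, ψ₂)`. -/
def Pi2 (ψ : ℝ × ℝ → R3) (p : ℝ × ℝ) : ℝ × ℝ := ((ψ p).1, (ψ p).2.1)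

def comp1 (ψ : ℝ × ℝ → R3) : ℝ × ℝ → ℝ := fun p => (ψ p).1
def comp2 (ψ : ℝ × ℝ → R3) : ℝ × ℝ → ℝ := fun p => (ψ p).2.1
def comp3 (ψ : ℝ × ℝ → R3) : ℝ × ℝ → ℝ := fun p => (ψ p).2.2

/-- `ψ : ℝ × (0,R) → ℝ³` is a conformal parametrization of the graph of `z` near the
singularity `(x₀,y₀)`: it is 2π-periodic in `u`, its planar projection induces a
diffeomorphism with positive Jacobian from `(ℝ/2πℤ) × (0,R)` onto a punctured
neighborhood `W ⊆ Ω` of `(x₀,y₀)`, its third component is `z` of the first two, and the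
conformality conditions hold. -/
def IsConfParam (z : ℝ × ℝ → ℝ) (Ω : Set (ℝ × ℝ)) (x₀ y₀ R : ℝ)
    (ψ : ℝ × ℝ → R3) : Prop :=
  0 < R ∧
  ContDiffOn ℝ 1 ψ (Strip R) ∧
  (∀ u v : ℝ, ψ (u + 2 * π, v) = ψ (u, v)) ∧
  (∃ W : Set (ℝ × ℝ), W ⊆ Ω ∧ ((x₀, y₀) : ℝ × ℝ) ∉ W ∧
      insert ((x₀, y₀) : ℝ × ℝ) W ∈ nhds ((x₀, y₀) : ℝ × ℝ) ∧
      Pi2 ψ '' Strip R = W) ∧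
  (∀ p ∈ Strip R, ∀ q ∈ Strip R, Pi2 ψ p = Pi2 ψ q →
      p.2 = q.2 ∧ ∃ n : ℤ, p.1 - q.1 = 2 * π * n) ∧
  (∀ p ∈ Strip R,
      0 < pd1 (comp1 ψ) p * pd2 (comp2 ψ) p - pd2 (comp1 ψ) p * pd1 (comp2 ψ) p) ∧
  (∀ p ∈ Strip R, comp3 ψ p = z (Pi2 ψ p)) ∧
  (∀ p ∈ Strip R,
      lor (pd1 ψ p) (pd1 ψ p) = lor (pd2 ψ p) (pd2 ψ p) ∧
      0 < lor (pd1 ψ p) (pd1 ψ p) ∧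
      lor (pd1 ψ p) (pd2 ψ p) = 0)

/-- `ψ` extends real-analytically across `v = 0`, with `ψ(u,0) = p₀` and
`∂_vψ(u,0) = A(u)(cos u, −sin u, 1)`. -/
def ExtAnal (ψ : ℝ × ℝ → R3) (R : ℝ) (p₀ : R3) (A : ℝ → ℝ) : Prop :=
  ∃ ε > 0, ∃ Ψ : ℝ × ℝ → R3,
    AnalyticOnNhd ℝ Ψ {p : ℝ × ℝ | -ε < p.2 ∧ p.2 < R} ∧
    (∀ p ∈ Strip R, Ψ p = ψ p) ∧
    (∀ u : ℝ, Ψ (u, 0) = p₀) ∧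
    (∀ u : ℝ, pd2 Ψ (u, 0) = (A u * Real.cos u, -(A u * Real.sin u), A u))

/-- The class `𝒜₂` of 2π-periodic, real-analytic, nowhere vanishing functions. -/
def MemA2 (A : ℝ → ℝ) : Prop :=
  AnalyticOnNhd ℝ A univ ∧ (∀ u : ℝ, A (u + 2 * π) = A u) ∧ ∀ u : ℝ, A u ≠ 0

/-- The class `𝒜₁`: elliptic solutions on a punctured disk of radius `ρ` centered at
`(x₀,y₀)`, extending continuously with value `z₀`, whose Hessian determinant is
nonvanishing on a punctured neighborhood of `(x₀,y₀)`. -/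
def MemA1 (H : R3 → ℝ) (O : Set R3) (x₀ y₀ z₀ ρ : ℝ) (z : ℝ × ℝ → ℝ) : Prop :=
  0 < ρ ∧ IsEllSol H O (PDisk x₀ y₀ ρ) z ∧
  Tendsto z (nhdsWithin ((x₀, y₀) : ℝ × ℝ) (PDisk x₀ y₀ ρ)) (nhds z₀) ∧
  ∃ ε : ℝ, 0 < ε ∧ ε ≤ ρ ∧ ∀ p ∈ PDisk x₀ y₀ ε, hessDet z p ≠ 0

/-- `z` corresponds to `A`: some conformal parametrization of the graph of `z` near the
singularity extends real-analytically across `v = 0` with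
`∂_vψ(u,0) = A(u)(cos u, −sin u, 1)`. -/
def Corr (z : ℝ × ℝ → ℝ) (x₀ y₀ z₀ ρ : ℝ) (A : ℝ → ℝ) : Prop :=
  ∃ R : ℝ, ∃ ψ : ℝ × ℝ → R3,
    IsConfParam z (PDisk x₀ y₀ ρ) x₀ y₀ R ψ ∧ ExtAnal ψ R ((x₀, y₀, z₀) : R3) A

/-- The induced (first fundamental form) metric of the graph of `z`,
`ds² = (1−z_x²)dx² − 2 z_x z_y dx dy + (1−z_y²)dy²`, as a bilinear form. -/
def dsq (z : ℝ × ℝ → ℝ) (p : ℝ × ℝ) (ξ η : ℝ × ℝ) : ℝ :=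
  (1 - (zx z p) ^ 2) * ξ.1 * η.1 - zx z p * zy z p * (ξ.1 * η.2 + ξ.2 * η.1)
    + (1 - (zy z p) ^ 2) * ξ.2 * η.2

/-- `(Ω, ds²)` is conformally equivalent to the planar domain `D`: there is a `C¹`
diffeomorphism `Φ : Ω → D` and a positive function `λ` with
`⟨DΦ(ξ), DΦ(η)⟩_euc = λ · ds²(ξ,η)`. -/
def ConfEquiv (z : ℝ × ℝ → ℝ) (Ω D : Set (ℝ × ℝ)) : Prop :=
  ∃ (Φ : ℝ × ℝ → ℝ × ℝ) (Φinv : ℝ × ℝ → ℝ × ℝ) (lam : ℝ × ℝ → ℝ),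
    ContDiffOn ℝ 1 Φ Ω ∧ ContDiffOn ℝ 1 Φinv D ∧
    (∀ p ∈ Ω, Φ p ∈ D ∧ Φinv (Φ p) = p) ∧
    (∀ q ∈ D, Φinv q ∈ Ω ∧ Φ (Φinv q) = q) ∧
    (∀ p ∈ Ω, 0 < lam p ∧
      ∀ ξ η : ℝ × ℝ, (fderiv ℝ Φ p ξ).1 * (fderiv ℝ Φ p η).1
          + (fderiv ℝ Φ p ξ).2 * (fderiv ℝ Φ p η).2 = lam p * dsq z p ξ η)

/-- Rotation of angle `θ` around the vertical axis through the origin of `ℝ³`. -/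
def rotZ (θ : ℝ) (p : R3) : R3 :=
  (p.1 * Real.cos θ - p.2.1 * Real.sin θ, p.1 * Real.sin θ + p.2.1 * Real.cos θ, p.2.2)

section PartialDerivatives

lemma fderiv_fun_mul_apply {f g : ℝ × ℝ → ℝ} {p : ℝ × ℝ} (hf : DifferentiableAt ℝ f p)
    (hg : DifferentiableAt ℝ g p) (w : ℝ × ℝ) :
    fderiv ℝ (fun q => f q * g q) p w = f p * fderiv ℝ g p w + g p * fderiv ℝ f p w := by
  rw [fderiv_fun_mul hf hg]
  simp

lemma pd1_mul {f g : ℝ × ℝ → ℝ} {p : ℝ × ℝ} (hf : DifferentiableAt ℝ f p)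
    (hg : DifferentiableAt ℝ g p) :
    pd1 (fun q => f q * g q) p = f p * pd1 g p + g p * pd1 f p :=
  fderiv_fun_mul_apply hf hg _

lemma pd2_mul {f g : ℝ × ℝ → ℝ} {p : ℝ × ℝ} (hf : DifferentiableAt ℝ f p)
    (hg : DifferentiableAt ℝ g p) :
    pd2 (fun q => f q * g q) p = f p * pd2 g p + g p * pd2 f p :=
  fderiv_fun_mul_apply hf hg _

lemma pd1_add {f g : ℝ × ℝ → ℝ} {p : ℝ × ℝ} (hf : DifferentiableAt ℝ f p)
    (hg : DifferentiableAt ℝ g p) :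
    pd1 (fun q => f q + g q) p = pd1 f p + pd1 g p := by
  simp [pd1, fderiv_fun_add hf hg]

lemma pd2_add {f g : ℝ × ℝ → ℝ} {p : ℝ × ℝ} (hf : DifferentiableAt ℝ f p)
    (hg : DifferentiableAt ℝ g p) :
    pd2 (fun q => f q + g q) p = pd2 f p + pd2 g p := by
  simp [pd2, fderiv_fun_add hf hg]

lemma pd1_sub {f g : ℝ × ℝ → ℝ} {p : ℝ × ℝ} (hf : DifferentiableAt ℝ f p)
    (hg : DifferentiableAt ℝ g p) :
    pd1 (fun q => f q - g q) p = pd1 f p - pd1 g p := by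
  simp [pd1, fderiv_fun_sub hf hg]

lemma pd2_sub {f g : ℝ × ℝ → ℝ} {p : ℝ × ℝ} (hf : DifferentiableAt ℝ f p)
    (hg : DifferentiableAt ℝ g p) :
    pd2 (fun q => f q - g q) p = pd2 f p - pd2 g p := by
  simp [pd2, fderiv_fun_sub hf hg]

lemma pd1_const (c : ℝ) (p : ℝ × ℝ) : pd1 (fun _ => c) p = 0 := by
  simp [pd1]

lemma pd2_const (c : ℝ) (p : ℝ × ℝ) : pd2 (fun _ => c) p = 0 := by
  simp [pd2]

lemma pd1_congr {f g : ℝ × ℝ → ℝ} {p : ℝ × ℝ} (h : f =ᶠ[nhds p] g) :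
    pd1 f =ᶠ[nhds p] pd1 g := by
  filter_upwards [h.fderiv (𝕜 := ℝ)] with q hq
  simp [pd1, hq]

lemma pd2_congr {f g : ℝ × ℝ → ℝ} {p : ℝ × ℝ} (h : f =ᶠ[nhds p] g) :
    pd2 f =ᶠ[nhds p] pd2 g := by
  filter_upwards [h.fderiv (𝕜 := ℝ)] with q hq
  simp [pd2, hq]

lemma fderiv_apply_eq_pd {f : ℝ × ℝ → ℝ} {p : ℝ × ℝ} (a b : ℝ) :
    fderiv ℝ f p (a, b) = pd1 f p * a + pd2 f p * b := by
  have h : ((a, b) : ℝ × ℝ) = a • (1, 0) + b • (0, 1) := by simp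
  rw [h, map_add, map_smul, map_smul]
  simp only [pd1, pd2, smul_eq_mul]
  ring

lemma pd2_pd1_comm {f : ℝ × ℝ → ℝ} {p : ℝ × ℝ} (hf : ContDiffAt ℝ 2 f p) :
    pd2 (pd1 f) p = pd1 (pd2 f) p := by
  have hd : DifferentiableAt ℝ (fderiv ℝ f) p :=
    (hf.fderiv_right (m := 1) (by norm_num)).differentiableAt (by norm_num)
  have key : ∀ w w' : ℝ × ℝ,
      fderiv ℝ (fun q => fderiv ℝ f q w) p w' = fderiv ℝ (fderiv ℝ f) p w' w := by
    intro w w'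
    have := (hd.hasFDerivAt.clm_apply (hasFDerivAt_const w p)).fderiv
    rw [this]
    simp
  have hs := hf.isSymmSndFDerivAt (by simp)
  change fderiv ℝ (fun q => fderiv ℝ f q (1, 0)) p (0, 1)
    = fderiv ℝ (fun q => fderiv ℝ f q (0, 1)) p (1, 0)
  rw [key, key]
  exact hs.eq _ _

lemma AnalyticAt.pd1 {f : ℝ × ℝ → ℝ} {p : ℝ × ℝ} (hf : AnalyticAt ℝ f p) :
    AnalyticAt ℝ (pd1 f) p :=
  ((ContinuousLinearMap.apply ℝ ℝ ((1, 0) : ℝ × ℝ)).analyticAt _).comp hf.fderiv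

lemma AnalyticAt.pd2 {f : ℝ × ℝ → ℝ} {p : ℝ × ℝ} (hf : AnalyticAt ℝ f p) :
    AnalyticAt ℝ (pd2 f) p :=
  ((ContinuousLinearMap.apply ℝ ℝ ((0, 1) : ℝ × ℝ)).analyticAt _).comp hf.fderiv

lemma ContDiffAt.differentiableAt_pd {f : ℝ × ℝ → ℝ} {p : ℝ × ℝ} (hf : ContDiffAt ℝ 2 f p) :
    DifferentiableAt ℝ (_root_.pd1 f) p ∧ DifferentiableAt ℝ (_root_.pd2 f) p := by
  have hd : DifferentiableAt ℝ (fderiv ℝ f) p :=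
    (hf.fderiv_right (m := 1) (by norm_num)).differentiableAt (by norm_num)
  exact ⟨hd.clm_apply (differentiableAt_const _), hd.clm_apply (differentiableAt_const _)⟩

/-- Chain rule for the composition of a function of two variables with a planar map. -/
lemma pd_comp₂ {f a b : ℝ × ℝ → ℝ} {p : ℝ × ℝ} (hf : DifferentiableAt ℝ f (a p, b p))
    (ha : DifferentiableAt ℝ a p) (hb : DifferentiableAt ℝ b p) :
    pd1 (fun q => f (a q, b q)) p = pd1 f (a p, b p) * pd1 a p + pd2 f (a p, b p) * pd1 b p ∧
    pd2 (fun q => f (a q, b q)) p = pd1 f (a p, b p) * pd2 a p + pd2 f (a p, b p) * pd2 b p := by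
  have h := (HasFDerivAt.comp p (f := fun q => (a q, b q)) hf.hasFDerivAt
    (ha.hasFDerivAt.prodMk hb.hasFDerivAt)).fderiv
  have h' : ∀ w, fderiv ℝ (fun q => f (a q, b q)) p w
      = pd1 f (a p, b p) * fderiv ℝ a p w + pd2 f (a p, b p) * fderiv ℝ b p w := by
    intro w
    rw [← fderiv_apply_eq_pd]
    exact congrArg (fun L => L w) h
  exact ⟨h' _, h' _⟩

lemma hasDerivAt_fst_line {f : ℝ × ℝ → ℝ} {u v : ℝ} (hf : DifferentiableAt ℝ f (u, v)) :
    HasDerivAt (fun s => f (s, v)) (pd1 f (u, v)) u :=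
  HasFDerivAt.comp_hasDerivAt (f := fun s => (s, v)) u hf.hasFDerivAt
    ((hasDerivAt_id u).prodMk (hasDerivAt_const u v))

lemma hasDerivAt_snd_line {f : ℝ × ℝ → ℝ} {u v : ℝ} (hf : DifferentiableAt ℝ f (u, v)) :
    HasDerivAt (fun s => f (u, s)) (pd2 f (u, v)) v :=
  HasFDerivAt.comp_hasDerivAt (f := fun s => (u, s)) v hf.hasFDerivAt
    ((hasDerivAt_const v u).prodMk (hasDerivAt_id v))

end PartialDerivatives

section VanishingOrder

/-- `f` is real-analytic at every point of the axis `v = 0`. -/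
def AxisAnalytic (f : ℝ × ℝ → ℝ) : Prop := ∀ u : ℝ, AnalyticAt ℝ f (u, 0)

/-- `f` vanishes along the axis `v = 0` together with its first `k - 1` normal derivatives. -/
def VanishesToOrder : ℕ → (ℝ × ℝ → ℝ) → Prop
  | 0, _ => True
  | k + 1, f => (∀ u : ℝ, f (u, 0) = 0) ∧ VanishesToOrder k (pd2 f)

lemma AxisAnalytic.pd1 {f : ℝ × ℝ → ℝ} (hf : AxisAnalytic f) : AxisAnalytic (pd1 f) :=
  fun u => (hf u).pd1

lemma AxisAnalytic.pd2 {f : ℝ × ℝ → ℝ} (hf : AxisAnalytic f) : AxisAnalytic (pd2 f) :=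
  fun u => (hf u).pd2

lemma AxisAnalytic.add {f g : ℝ × ℝ → ℝ} (hf : AxisAnalytic f) (hg : AxisAnalytic g) :
    AxisAnalytic (fun p => f p + g p) := fun u => (hf u).fun_add (hg u)

lemma AxisAnalytic.sub {f g : ℝ × ℝ → ℝ} (hf : AxisAnalytic f) (hg : AxisAnalytic g) :
    AxisAnalytic (fun p => f p - g p) := fun u => (hf u).fun_sub (hg u)

lemma AxisAnalytic.mul {f g : ℝ × ℝ → ℝ} (hf : AxisAnalytic f) (hg : AxisAnalytic g) :
    AxisAnalytic (fun p => f p * g p) := fun u => (hf u).fun_mul (hg u)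

lemma AxisAnalytic.const (c : ℝ) : AxisAnalytic (fun _ => c) := fun _ => analyticAt_const

lemma VanishesToOrder.congr {k : ℕ} {f g : ℝ × ℝ → ℝ}
    (h : ∀ u : ℝ, f =ᶠ[nhds (u, 0)] g) (hf : VanishesToOrder k f) : VanishesToOrder k g := by
  induction k generalizing f g with
  | zero => trivial
  | succ k ih =>
    exact ⟨fun u => (h u).eq_of_nhds ▸ hf.1 u, ih (fun u => pd2_congr (h u)) hf.2⟩

lemma VanishesToOrder.of_succ {k : ℕ} {f : ℝ × ℝ → ℝ} (hf : VanishesToOrder (k + 1) f) :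
    VanishesToOrder k f := by
  induction k generalizing f with
  | zero => trivial
  | succ k ih => exact ⟨hf.1, ih hf.2⟩

lemma AxisAnalytic.eventually {f : ℝ × ℝ → ℝ} (hf : AxisAnalytic f) (u : ℝ) :
    ∀ᶠ p in nhds ((u, 0) : ℝ × ℝ), DifferentiableAt ℝ f p :=
  (hf u).eventually_analyticAt.mono fun _ h => h.differentiableAt

lemma VanishesToOrder.add {k : ℕ} {f g : ℝ × ℝ → ℝ} (hfa : AxisAnalytic f)
    (hga : AxisAnalytic g) (hf : VanishesToOrder k f) (hg : VanishesToOrder k g) :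
    VanishesToOrder k (fun p => f p + g p) := by
  induction k generalizing f g with
  | zero => trivial
  | succ k ih =>
    refine ⟨fun u => by simp [hf.1 u, hg.1 u], (ih hfa.pd2 hga.pd2 hf.2 hg.2).congr fun u => ?_⟩
    filter_upwards [hfa.eventually u, hga.eventually u] with p h₁ h₂
    exact (pd2_add h₁ h₂).symm

lemma VanishesToOrder.mul_right {k : ℕ} {f g : ℝ × ℝ → ℝ} (hfa : AxisAnalytic f)
    (hga : AxisAnalytic g) (hg : VanishesToOrder k g) :
    VanishesToOrder k (fun p => f p * g p) := by
  induction k generalizing f g with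
  | zero => trivial
  | succ k ih =>
    refine ⟨fun u => by simp [hg.1 u],
      (VanishesToOrder.add (hfa.mul hga.pd2) (hga.mul hfa.pd2) (ih hfa hga.pd2 hg.2) ?_).congr
        fun u => ?_⟩
    · have := ih hfa.pd2 hga hg.of_succ
      simpa only [mul_comm] using this
    · filter_upwards [hfa.eventually u, hga.eventually u] with p h₁ h₂
      exact (pd2_mul h₁ h₂).symm

lemma VanishesToOrder.sub {k : ℕ} {f g : ℝ × ℝ → ℝ} (hfa : AxisAnalytic f)
    (hga : AxisAnalytic g) (hf : VanishesToOrder k f) (hg : VanishesToOrder k g) :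
    VanishesToOrder k (fun p => f p - g p) := by
  have h := hf.add hfa ((AxisAnalytic.const (-1)).mul hga)
    (hg.mul_right (AxisAnalytic.const (-1)) hga)
  simpa only [neg_one_mul, ← sub_eq_add_neg] using h

lemma VanishesToOrder.pd1 {k : ℕ} {f : ℝ × ℝ → ℝ} (hfa : AxisAnalytic f)
    (hf : VanishesToOrder k f) : VanishesToOrder k (pd1 f) := by
  induction k generalizing f with
  | zero => trivial
  | succ k ih =>
    refine ⟨fun u => ?_, (ih hfa.pd2 hf.2).congr fun u => ?_⟩
    · have h := hasDerivAt_fst_line (hfa u).differentiableAt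
      simp only [hf.1] at h
      exact h.unique (hasDerivAt_const u 0)
    · filter_upwards [(hfa u).eventually_analyticAt] with p hp
      exact (pd2_pd1_comm hp.contDiffAt).symm

lemma iteratedDeriv_eq_zero_of_vanishes {f : ℝ × ℝ → ℝ} (hfa : AxisAnalytic f)
    (hf : ∀ k, VanishesToOrder k f) (u : ℝ) (n : ℕ) :
    iteratedDeriv n (fun v => f (u, v)) 0 = 0 := by
  induction n generalizing f with
  | zero => simpa using (hf 1).1 u
  | succ n ih =>
    rw [iteratedDeriv_succ']
    refine (Filter.EventuallyEq.iteratedDeriv_eq n ?_).trans (ih hfa.pd2 fun k => (hf (k + 1)).2)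
    have hc : Tendsto (fun v : ℝ => ((u, v) : ℝ × ℝ)) (nhds 0) (nhds (u, 0)) :=
      (Continuous.prodMk_right u).tendsto 0
    filter_upwards [hc.eventually (hfa.eventually u)] with v hv
    exact (hasDerivAt_snd_line hv).deriv

lemma eventually_zero_of_vanishes {f : ℝ × ℝ → ℝ} (hfa : AxisAnalytic f)
    (hf : ∀ k, VanishesToOrder k f) (u : ℝ) : ∀ᶠ v in nhds (0 : ℝ), f (u, v) = 0 := by
  have ha : AnalyticAt ℝ (fun v => f (u, v)) 0 :=
    AnalyticAt.fun_comp (f := fun v : ℝ => (u, v)) (g := f) (hfa u)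
      (analyticAt_const.prod analyticAt_id)
  refine analyticOrderAt_eq_top.1 (ENat.eq_top_iff_forall_ge.2 fun n => ?_)
  exact (natCast_le_analyticOrderAt_iff_iteratedDeriv_eq_zero ha).2 fun i _ =>
    iteratedDeriv_eq_zero_of_vanishes hfa hf u i

/-- A function analytic at a point of the axis that vanishes for `v > 0` vanishes near it. -/
lemma AnalyticAt.eventually_zero_of_upper {f : ℝ × ℝ → ℝ} {u : ℝ} (hf : AnalyticAt ℝ f (u, 0))
    (h : ∀ᶠ p in nhds ((u, 0) : ℝ × ℝ), 0 < p.2 → f p = 0) : f =ᶠ[nhds (u, 0)] 0 := by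
  obtain ⟨δ, hδ, hb⟩ := Metric.eventually_nhds_iff_ball.1 (hf.eventually_analyticAt.and h)
  have hmem : ((u, δ / 2) : ℝ × ℝ) ∈ ball ((u, 0) : ℝ × ℝ) δ := by
    rw [mem_ball, Prod.dist_eq]
    simp [abs_of_pos hδ, hδ]
  have hz : f =ᶠ[nhds ((u, δ / 2) : ℝ × ℝ)] 0 := by
    have h2 : ∀ᶠ p : ℝ × ℝ in nhds ((u, δ / 2) : ℝ × ℝ), 0 < p.2 :=
      continuous_snd.continuousAt.eventually (lt_mem_nhds (by simpa using hδ))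
    filter_upwards [isOpen_ball.mem_nhds hmem, h2] with p hp hp2
    exact (hb p hp).2 hp2
  have := AnalyticOnNhd.eqOn_zero_of_preconnected_of_eventuallyEq_zero
    (fun p hp => (hb p hp).1) (convex_ball _ _).isPreconnected hmem hz
  filter_upwards [ball_mem_nhds _ hδ] with p hp
  exact this hp

end VanishingOrder

section GraphParametrization

/-- The scalar components `X, Y, Z` of an analytic extension of a conformal parametrization of
the graph of `z` with isolated singularity at `(x₀, y₀)`. -/
structure IsGraphParam (z : ℝ × ℝ → ℝ) (A : ℝ → ℝ) (x₀ y₀ z₀ ρ ε R : ℝ)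
    (X Y Z : ℝ × ℝ → ℝ) : Prop where
  eps_pos : 0 < ε
  R_pos : 0 < R
  analytic_X : ∀ p : ℝ × ℝ, -ε < p.2 → p.2 < R → AnalyticAt ℝ X p
  analytic_Y : ∀ p : ℝ × ℝ, -ε < p.2 → p.2 < R → AnalyticAt ℝ Y p
  analytic_Z : ∀ p : ℝ × ℝ, -ε < p.2 → p.2 < R → AnalyticAt ℝ Z p
  axis_X : ∀ u : ℝ, X (u, 0) = x₀
  axis_Y : ∀ u : ℝ, Y (u, 0) = y₀
  axis_Z : ∀ u : ℝ, Z (u, 0) = z₀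
  pd2_X : ∀ u : ℝ, pd2 X (u, 0) = A u * Real.cos u
  pd2_Y : ∀ u : ℝ, pd2 Y (u, 0) = -(A u * Real.sin u)
  pd2_Z : ∀ u : ℝ, pd2 Z (u, 0) = A u
  mem : ∀ p ∈ Strip R, (X p, Y p) ∈ PDisk x₀ y₀ ρ
  graph : ∀ p ∈ Strip R, Z p = z (X p, Y p)
  conf_eq : ∀ p ∈ Strip R, pd1 X p * pd1 X p + pd1 Y p * pd1 Y p - pd1 Z p * pd1 Z p
    = pd2 X p * pd2 X p + pd2 Y p * pd2 Y p - pd2 Z p * pd2 Z p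
  conf_orth : ∀ p ∈ Strip R,
    pd1 X p * pd2 X p + pd1 Y p * pd2 Y p - pd1 Z p * pd2 Z p = 0
  conf_pos : ∀ p ∈ Strip R,
    0 < pd1 X p * pd1 X p + pd1 Y p * pd1 Y p - pd1 Z p * pd1 Z p
  jac_pos : ∀ p ∈ Strip R, 0 < pd1 X p * pd2 Y p - pd2 X p * pd1 Y p
  surj : ∃ r : ℝ, 0 < r ∧ r ≤ ρ ∧ ∀ q ∈ PDisk x₀ y₀ r, ∃ p ∈ Strip R, (X p, Y p) = q

lemma isOpen_strip (R : ℝ) : IsOpen (Strip R) :=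
  (isOpen_lt continuous_const continuous_snd).inter (isOpen_lt continuous_snd continuous_const)

lemma isOpen_pDisk (x₀ y₀ ρ : ℝ) : IsOpen (PDisk x₀ y₀ ρ) :=
  IsOpen.and (isOpen_lt continuous_const
    (g := fun p : ℝ × ℝ => (p.1 - x₀) ^ 2 + (p.2 - y₀) ^ 2) (by fun_prop))
    (isOpen_lt (f := fun p : ℝ × ℝ => (p.1 - x₀) ^ 2 + (p.2 - y₀) ^ 2) (by fun_prop)
      continuous_const)

lemma pDisk_subset_ball {x₀ y₀ r : ℝ} (hr : 0 < r) {q : ℝ × ℝ} (hq : q ∈ PDisk x₀ y₀ r) :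
    q ∈ ball ((x₀, y₀) : ℝ × ℝ) r := by
  obtain ⟨-, hq⟩ := hq
  rw [mem_ball, Prod.dist_eq, max_lt_iff, Real.dist_eq, Real.dist_eq]
  constructor <;> refine abs_lt_of_sq_lt_sq ?_ hr.le <;>
    nlinarith [sq_nonneg (q.1 - x₀), sq_nonneg (q.2 - y₀)]

lemma fderiv_components {Ψ : ℝ × ℝ → R3} {p : ℝ × ℝ} (h : DifferentiableAt ℝ Ψ p)
    (w : ℝ × ℝ) : fderiv ℝ Ψ p w
      = (fderiv ℝ (comp1 Ψ) p w, fderiv ℝ (comp2 Ψ) p w, fderiv ℝ (comp3 Ψ) p w) := by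
  have h1 : fderiv ℝ (comp1 Ψ) p = _ := h.hasFDerivAt.fst.fderiv
  have h2 : fderiv ℝ (comp2 Ψ) p = _ := h.hasFDerivAt.snd.fst.fderiv
  have h3 : fderiv ℝ (comp3 Ψ) p = _ := h.hasFDerivAt.snd.snd.fderiv
  rw [h1, h2, h3]
  rfl

lemma Corr.exists_isGraphParam {z : ℝ × ℝ → ℝ} {x₀ y₀ z₀ ρ : ℝ} {A : ℝ → ℝ} (hρ : 0 < ρ)
    (hc : Corr z x₀ y₀ z₀ ρ A) :
    ∃ (ε R : ℝ) (X Y Z : ℝ × ℝ → ℝ), IsGraphParam z A x₀ y₀ z₀ ρ ε R X Y Z := by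
  obtain ⟨R, ψ, ⟨hR, -, -, ⟨W, hWsub, -, hWn, hWim⟩, -, hjac, hgr, hconf⟩,
    ε, hε, Ψ, hΨ, hΨψ, hΨ0, hΨv⟩ := hc
  have hst : ∀ p ∈ Strip R, ψ =ᶠ[nhds p] Ψ := fun p hp =>
    Filter.mem_of_superset ((isOpen_strip R).mem_nhds hp) fun q hq => (hΨψ q hq).symm
  have hdom : ∀ p ∈ Strip R, -ε < p.2 ∧ p.2 < R := fun p hp => ⟨by linarith [hp.1], hp.2⟩
  have hfd : ∀ p ∈ Strip R, fderiv ℝ ψ p = fderiv ℝ Ψ p := fun p hp => (hst p hp).fderiv_eq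
  have hpd1 : ∀ p ∈ Strip R,
      pd1 ψ p = (pd1 (comp1 Ψ) p, pd1 (comp2 Ψ) p, pd1 (comp3 Ψ) p) := fun p hp => by
    rw [pd1, hfd p hp, fderiv_components (hΨ p (hdom p hp)).differentiableAt]
    rfl
  have hpd2 : ∀ p ∈ Strip R,
      pd2 ψ p = (pd2 (comp1 Ψ) p, pd2 (comp2 Ψ) p, pd2 (comp3 Ψ) p) := fun p hp => by
    rw [pd2, hfd p hp, fderiv_components (hΨ p (hdom p hp)).differentiableAt]
    rfl
  have h0 : ∀ u : ℝ, DifferentiableAt ℝ Ψ (u, 0) := fun u =>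
    (hΨ (u, 0) ⟨by simpa using hε, by simpa using hR⟩).differentiableAt
  have hax : ∀ u : ℝ, (pd2 (comp1 Ψ) (u, 0), pd2 (comp2 Ψ) (u, 0), pd2 (comp3 Ψ) (u, 0))
      = ((A u * Real.cos u, -(A u * Real.sin u), A u) : R3) := fun u => by
    rw [← hΨv u]
    exact (fderiv_components (h0 u) _).symm
  have hPi : ∀ p ∈ Strip R, (comp1 Ψ p, comp2 Ψ p) = Pi2 ψ p := fun p hp => by
    simp [comp1, comp2, Pi2, hΨψ p hp]
  refine ⟨ε, R, comp1 Ψ, comp2 Ψ, comp3 Ψ, hε, hR, ?_, ?_, ?_, ?_, ?_, ?_, ?_, ?_, ?_, ?_, ?_, ?_,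
    ?_, ?_, ?_, ?_⟩
  · exact fun p h1 h2 =>
      ((ContinuousLinearMap.fst ℝ ℝ (ℝ × ℝ)).analyticAt _).comp (hΨ p ⟨h1, h2⟩)
  · exact fun p h1 h2 => (((ContinuousLinearMap.fst ℝ ℝ ℝ).comp
      (ContinuousLinearMap.snd ℝ ℝ (ℝ × ℝ))).analyticAt _).comp (hΨ p ⟨h1, h2⟩)
  · exact fun p h1 h2 => (((ContinuousLinearMap.snd ℝ ℝ ℝ).comp
      (ContinuousLinearMap.snd ℝ ℝ (ℝ × ℝ))).analyticAt _).comp (hΨ p ⟨h1, h2⟩)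
  · exact fun u => by simp [comp1, hΨ0 u]
  · exact fun u => by simp [comp2, hΨ0 u]
  · exact fun u => by simp [comp3, hΨ0 u]
  · exact fun u => congrArg (fun t : R3 => t.1) (hax u)
  · exact fun u => congrArg (fun t : R3 => t.2.1) (hax u)
  · exact fun u => congrArg (fun t : R3 => t.2.2) (hax u)
  · exact fun p hp => by rw [hPi p hp]; exact hWsub (hWim ▸ mem_image_of_mem _ hp)
  · exact fun p hp => by rw [hPi p hp, ← hgr p hp]; simp [comp3, hΨψ p hp]
  · intro p hp
    have := (hconf p hp).1
    rwa [hpd1 p hp, hpd2 p hp] at this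
  · intro p hp
    have := (hconf p hp).2.2
    rwa [hpd1 p hp, hpd2 p hp] at this
  · intro p hp
    have := (hconf p hp).2.1
    rwa [hpd1 p hp] at this
  · intro p hp
    have h1 : fderiv ℝ (comp1 ψ) p = fderiv ℝ (comp1 Ψ) p :=
      ((hst p hp).fun_comp (fun t : R3 => t.1)).fderiv_eq
    have h2 : fderiv ℝ (comp2 ψ) p = fderiv ℝ (comp2 Ψ) p :=
      ((hst p hp).fun_comp (fun t : R3 => t.2.1)).fderiv_eq
    have := hjac p hp
    simpa only [pd1, pd2, h1, h2] using this
  · obtain ⟨r, hr, hrW⟩ := Metric.mem_nhds_iff.1 hWn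
    refine ⟨min r ρ, lt_min hr hρ, min_le_right _ _, fun q hq => ?_⟩
    have hqW : q ∈ W := by
      have hqb := hrW (ball_subset_ball (min_le_left _ _)
        (pDisk_subset_ball (lt_min hr hρ) hq))
      refine hqb.resolve_left fun h => ?_
      have := hq.1
      simp [h] at this
    rw [← hWim] at hqW
    obtain ⟨p, hp, rfl⟩ := hqW
    exact ⟨p, hp, hPi p hp⟩

/-- Pointwise algebra behind the mean curvature equation in conformal coordinates. -/
lemma mean_curvature_algebra {p q r s t h xu xv yu yv d₁ d₂ d₃ L : ℝ}
    (hW : p ^ 2 + q ^ 2 < 1) (hJ : 0 < xu * yv - xv * yu) (hL : 0 < L)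
    (e₁ : xu * xu + yu * yu - (p * xu + q * yu) * (p * xu + q * yu) = L)
    (e₂ : xv * xv + yv * yv - (p * xv + q * yv) * (p * xv + q * yv) = L)
    (e₃ : xu * xv + yu * yv - (p * xu + q * yu) * (p * xv + q * yv) = 0)
    (o₁ : d₁ * xu + d₂ * yu - d₃ * (p * xu + q * yu) = 0)
    (o₂ : d₁ * xv + d₂ * yv - d₃ * (p * xv + q * yv) = 0)
    (hT : d₃ - p * d₁ - q * d₂
      = r * (xu * xu + xv * xv) + 2 * s * (xu * yu + xv * yv) + t * (yu * yu + yv * yv))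
    (hpde : (1 - q ^ 2) * r + 2 * p * q * s + (1 - p ^ 2) * t
      = 2 * h * (1 - p ^ 2 - q ^ 2) ^ ((3 : ℝ) / 2)) :
    d₁ = 2 * h * ((xu * yv - xv * yu) * p) ∧ d₂ = 2 * h * ((xu * yv - xv * yu) * q) ∧
      d₃ = 2 * h * (xu * yv - xv * yu) := by
  set J := xu * yv - xv * yu with hJdef
  have hd₁ : d₁ = d₃ * p := by
    have : J * (d₁ - d₃ * p) = 0 := by
      rw [hJdef]; linear_combination yv * o₁ - yu * o₂
    rcases mul_eq_zero.1 this with h0 | h0 <;> linarith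
  have hd₂ : d₂ = d₃ * q := by
    have : J * (d₂ - d₃ * q) = 0 := by
      rw [hJdef]; linear_combination xu * o₂ - xv * o₁
    rcases mul_eq_zero.1 this with h0 | h0 <;> linarith
  have hw0 : 0 < 1 - p ^ 2 - q ^ 2 := by linarith
  obtain ⟨w, hw, hw2⟩ : ∃ w : ℝ, 0 < w ∧ w ^ 2 = 1 - p ^ 2 - q ^ 2 :=
    ⟨√(1 - p ^ 2 - q ^ 2), Real.sqrt_pos.2 hw0, Real.sq_sqrt hw0.le⟩
  have hw3 : (1 - p ^ 2 - q ^ 2) ^ ((3 : ℝ) / 2) = w ^ 3 := by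
    rw [← hw2, ← Real.rpow_natCast w 2, ← Real.rpow_mul hw.le, ← Real.rpow_natCast w 3]
    norm_num
  rw [hw3] at hpde
  have hLJ : L = w * J := by
    have : L ^ 2 = (w * J) ^ 2 := by
      rw [mul_pow, hw2, hJdef]
      linear_combination (-L) * e₁ + (-(xu * xu + yu * yu
        - (p * xu + q * yu) * (p * xu + q * yu))) * e₂ + (xu * xv + yu * yv
        - (p * xu + q * yu) * (p * xv + q * yv)) * e₃
    exact (pow_left_inj₀ hL.le (mul_pos hw hJ).le two_ne_zero).1 this
  have ha : J ^ 2 * (1 - q ^ 2) = L * (xu * xu + xv * xv) := by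
    rw [hJdef]; linear_combination xv ^ 2 * e₁ + xu ^ 2 * e₂ - 2 * xu * xv * e₃
  have hc : J ^ 2 * (1 - p ^ 2) = L * (yu * yu + yv * yv) := by
    rw [hJdef]; linear_combination yv ^ 2 * e₁ + yu ^ 2 * e₂ - 2 * yu * yv * e₃
  have hb : J ^ 2 * (p * q) = L * (xu * yu + xv * yv) := by
    rw [hJdef]
    linear_combination xv * yv * e₁ + xu * yu * e₂ - (xu * yv + xv * yu) * e₃
  have hd₃ : d₃ = 2 * h * J := by
    have hT' : d₃ * w ^ 2 = r * (xu * xu + xv * xv) + 2 * s * (xu * yu + xv * yv)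
        + t * (yu * yu + yv * yv) := by
      rw [← hT, hd₁, hd₂, hw2]; ring
    have : (w ^ 3 * J) * (d₃ - 2 * h * J) = 0 := by
      have h1 : L * (d₃ * w ^ 2) = J ^ 2 * (2 * h * w ^ 3) := by
        rw [hT', ← hpde]; linear_combination (-r) * ha - 2 * s * hb - t * hc
      rw [hLJ] at h1
      linear_combination h1
    rcases mul_eq_zero.1 this with h0 | h0
    · exact absurd h0 (by positivity)
    · linarith
  exact ⟨by rw [hd₁, hd₃]; ring, by rw [hd₂, hd₃]; ring, hd₃⟩

lemma pd1_form {a₁ a₂ a₃ b₁ b₂ b₃ : ℝ × ℝ → ℝ} {p : ℝ × ℝ}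
    (ha₁ : DifferentiableAt ℝ a₁ p) (ha₂ : DifferentiableAt ℝ a₂ p)
    (ha₃ : DifferentiableAt ℝ a₃ p) (hb₁ : DifferentiableAt ℝ b₁ p)
    (hb₂ : DifferentiableAt ℝ b₂ p) (hb₃ : DifferentiableAt ℝ b₃ p) :
    pd1 (fun q => a₁ q * b₁ q + a₂ q * b₂ q - a₃ q * b₃ q) p
      = (a₁ p * pd1 b₁ p + b₁ p * pd1 a₁ p) + (a₂ p * pd1 b₂ p + b₂ p * pd1 a₂ p)
        - (a₃ p * pd1 b₃ p + b₃ p * pd1 a₃ p) := by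
  rw [pd1_sub ((ha₁.fun_mul hb₁).fun_add (ha₂.fun_mul hb₂)) (ha₃.fun_mul hb₃),
    pd1_add (ha₁.fun_mul hb₁) (ha₂.fun_mul hb₂), pd1_mul ha₁ hb₁, pd1_mul ha₂ hb₂,
    pd1_mul ha₃ hb₃]

lemma pd2_form {a₁ a₂ a₃ b₁ b₂ b₃ : ℝ × ℝ → ℝ} {p : ℝ × ℝ}
    (ha₁ : DifferentiableAt ℝ a₁ p) (ha₂ : DifferentiableAt ℝ a₂ p)
    (ha₃ : DifferentiableAt ℝ a₃ p) (hb₁ : DifferentiableAt ℝ b₁ p)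
    (hb₂ : DifferentiableAt ℝ b₂ p) (hb₃ : DifferentiableAt ℝ b₃ p) :
    pd2 (fun q => a₁ q * b₁ q + a₂ q * b₂ q - a₃ q * b₃ q) p
      = (a₁ p * pd2 b₁ p + b₁ p * pd2 a₁ p) + (a₂ p * pd2 b₂ p + b₂ p * pd2 a₂ p)
        - (a₃ p * pd2 b₃ p + b₃ p * pd2 a₃ p) := by
  rw [pd2_sub ((ha₁.fun_mul hb₁).fun_add (ha₂.fun_mul hb₂)) (ha₃.fun_mul hb₃),
    pd2_add (ha₁.fun_mul hb₁) (ha₂.fun_mul hb₂), pd2_mul ha₁ hb₁, pd2_mul ha₂ hb₂,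
    pd2_mul ha₃ hb₃]

lemma AnalyticAt.contDiffAt_two {f : ℝ × ℝ → ℝ} {p : ℝ × ℝ} (hf : AnalyticAt ℝ f p) :
    ContDiffAt ℝ 2 f p := hf.contDiffAt

/-- Pure second derivatives of the composition of a `C²` function with a planar map. -/
lemma pd_pd_comp₂ {f a b : ℝ × ℝ → ℝ} {p : ℝ × ℝ} (hf : ContDiffAt ℝ 2 f (a p, b p))
    (ha : AnalyticAt ℝ a p) (hb : AnalyticAt ℝ b p) :
    pd1 (pd1 fun q => f (a q, b q)) p
      = pd1 (pd1 f) (a p, b p) * (pd1 a p * pd1 a p)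
        + 2 * pd2 (pd1 f) (a p, b p) * (pd1 a p * pd1 b p)
        + pd2 (pd2 f) (a p, b p) * (pd1 b p * pd1 b p)
        + pd1 f (a p, b p) * pd1 (pd1 a) p + pd2 f (a p, b p) * pd1 (pd1 b) p ∧
    pd2 (pd2 fun q => f (a q, b q)) p
      = pd1 (pd1 f) (a p, b p) * (pd2 a p * pd2 a p)
        + 2 * pd2 (pd1 f) (a p, b p) * (pd2 a p * pd2 b p)
        + pd2 (pd2 f) (a p, b p) * (pd2 b p * pd2 b p)
        + pd1 f (a p, b p) * pd2 (pd2 a) p + pd2 f (a p, b p) * pd2 (pd2 b) p := by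
  have hev : ∀ᶠ q in nhds p, DifferentiableAt ℝ f (a q, b q) ∧ DifferentiableAt ℝ a q ∧
      DifferentiableAt ℝ b q := by
    have h1 : ∀ᶠ q in nhds (a p, b p), DifferentiableAt ℝ f q :=
      (hf.eventually (by simp)).mono fun q hq => hq.differentiableAt (by norm_num)
    have hc : ContinuousAt (fun q => (a q, b q)) p :=
      ha.continuousAt.prodMk hb.continuousAt
    filter_upwards [hc.eventually h1, ha.eventually_analyticAt, hb.eventually_analyticAt]
      with q h2 h3 h4
    exact ⟨h2, h3.differentiableAt, h4.differentiableAt⟩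
  have had := ha.differentiableAt
  have hbd := hb.differentiableAt
  obtain ⟨hf1, hf2⟩ := hf.differentiableAt_pd
  have hf1c : DifferentiableAt ℝ (fun q => pd1 f (a q, b q)) p :=
    DifferentiableAt.fun_comp' p hf1 (had.prodMk hbd)
  have hf2c : DifferentiableAt ℝ (fun q => pd2 f (a q, b q)) p :=
    DifferentiableAt.fun_comp' p hf2 (had.prodMk hbd)
  have hsym := pd2_pd1_comm hf
  constructor
  · have h : pd1 (fun q => f (a q, b q)) =ᶠ[nhds p]
        fun q => pd1 f (a q, b q) * pd1 a q + pd2 f (a q, b q) * pd1 b q := by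
      filter_upwards [hev] with q hq using (pd_comp₂ hq.1 hq.2.1 hq.2.2).1
    rw [(pd1_congr h).eq_of_nhds, pd1_add (hf1c.fun_mul ha.pd1.differentiableAt)
      (hf2c.fun_mul hb.pd1.differentiableAt), pd1_mul hf1c ha.pd1.differentiableAt,
      pd1_mul hf2c hb.pd1.differentiableAt, (pd_comp₂ hf1 had hbd).1, (pd_comp₂ hf2 had hbd).1,
      ← hsym]
    ring
  · have h : pd2 (fun q => f (a q, b q)) =ᶠ[nhds p]
        fun q => pd1 f (a q, b q) * pd2 a q + pd2 f (a q, b q) * pd2 b q := by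
      filter_upwards [hev] with q hq using (pd_comp₂ hq.1 hq.2.1 hq.2.2).2
    rw [(pd2_congr h).eq_of_nhds, pd2_add (hf1c.fun_mul ha.pd2.differentiableAt)
      (hf2c.fun_mul hb.pd2.differentiableAt), pd2_mul hf1c ha.pd2.differentiableAt,
      pd2_mul hf2c hb.pd2.differentiableAt, (pd_comp₂ hf1 had hbd).2, (pd_comp₂ hf2 had hbd).2,
      ← hsym]
    ring

variable {H : R3 → ℝ} {O : Set R3} {z : ℝ × ℝ → ℝ} {A : ℝ → ℝ} {x₀ y₀ z₀ ρ ε R : ℝ}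
  {X Y Z : ℝ × ℝ → ℝ}

lemma IsGraphParam.analyticAt_strip (hg : IsGraphParam z A x₀ y₀ z₀ ρ ε R X Y Z) {p : ℝ × ℝ}
    (hp : p ∈ Strip R) : AnalyticAt ℝ X p ∧ AnalyticAt ℝ Y p ∧ AnalyticAt ℝ Z p := by
  have h : -ε < p.2 := by linarith [hp.1, hg.eps_pos]
  exact ⟨hg.analytic_X p h hp.2, hg.analytic_Y p h hp.2, hg.analytic_Z p h hp.2⟩

lemma IsGraphParam.pd_Z (hg : IsGraphParam z A x₀ y₀ z₀ ρ ε R X Y Z)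
    (hz : ContDiffOn ℝ 2 z (PDisk x₀ y₀ ρ)) {p : ℝ × ℝ} (hp : p ∈ Strip R) :
    pd1 Z p = zx z (X p, Y p) * pd1 X p + zy z (X p, Y p) * pd1 Y p ∧
    pd2 Z p = zx z (X p, Y p) * pd2 X p + zy z (X p, Y p) * pd2 Y p := by
  have hzp : ContDiffAt ℝ 2 z (X p, Y p) :=
    hz.contDiffAt ((isOpen_pDisk _ _ _).mem_nhds (hg.mem p hp))
  obtain ⟨hX, hY, -⟩ := hg.analyticAt_strip hp
  have hZ : Z =ᶠ[nhds p] fun q => z (X q, Y q) :=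
    Filter.mem_of_superset ((isOpen_strip R).mem_nhds hp) hg.graph
  have h := pd_comp₂ (hzp.differentiableAt (by norm_num)) hX.differentiableAt hY.differentiableAt
  rw [(pd1_congr hZ).eq_of_nhds, (pd2_congr hZ).eq_of_nhds]
  exact h

/-- A conformal parametrization of a graph of prescribed mean curvature `H` satisfies
`Δψ = 2 H(ψ) ψ_u ×_L ψ_v`. -/
lemma IsGraphParam.mean_curvature (hg : IsGraphParam z A x₀ y₀ z₀ ρ ε R X Y Z)
    (hz : IsEllSol H O (PDisk x₀ y₀ ρ) z) {p : ℝ × ℝ} (hp : p ∈ Strip R) :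
    pd1 (pd1 X) p + pd2 (pd2 X) p
      = 2 * H (X p, Y p, Z p) * (pd1 Z p * pd2 Y p - pd1 Y p * pd2 Z p) ∧
    pd1 (pd1 Y) p + pd2 (pd2 Y) p
      = 2 * H (X p, Y p, Z p) * (pd1 X p * pd2 Z p - pd1 Z p * pd2 X p) ∧
    pd1 (pd1 Z) p + pd2 (pd2 Z) p
      = 2 * H (X p, Y p, Z p) * (pd1 X p * pd2 Y p - pd1 Y p * pd2 X p) := by
  obtain ⟨hz2, -, hell, hpde⟩ := hz
  have hm := hg.mem p hp
  have hzp : ContDiffAt ℝ 2 z (X p, Y p) := hz2.contDiffAt ((isOpen_pDisk _ _ _).mem_nhds hm)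
  obtain ⟨hX, hY, hZ⟩ := hg.analyticAt_strip hp
  have hst : ∀ {f g : ℝ × ℝ → ℝ}, (∀ q ∈ Strip R, f q = g q) → f =ᶠ[nhds p] g :=
    fun h => Filter.mem_of_superset ((isOpen_strip R).mem_nhds hp) h
  obtain ⟨hZu, hZv⟩ := hg.pd_Z hz2 hp
  obtain ⟨hZuu, hZvv⟩ := pd_pd_comp₂ hzp hX hY
  rw [← (pd1_congr (pd1_congr (hst hg.graph))).eq_of_nhds] at hZuu
  rw [← (pd2_congr (pd2_congr (hst hg.graph))).eq_of_nhds] at hZvv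
  have dX1 := hX.pd1.differentiableAt
  have dX2 := hX.pd2.differentiableAt
  have dY1 := hY.pd1.differentiableAt
  have dY2 := hY.pd2.differentiableAt
  have dZ1 := hZ.pd1.differentiableAt
  have dZ2 := hZ.pd2.differentiableAt
  have cX := pd2_pd1_comm hX.contDiffAt_two
  have cY := pd2_pd1_comm hY.contDiffAt_two
  have cZ := pd2_pd1_comm hZ.contDiffAt_two
  have c1 := (pd1_congr (hst hg.conf_eq)).eq_of_nhds
  have c2 := (pd2_congr (hst hg.conf_eq)).eq_of_nhds
  have c3 := (pd1_congr (hst hg.conf_orth)).eq_of_nhds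
  have c4 := (pd2_congr (hst hg.conf_orth)).eq_of_nhds
  rw [pd1_form dX1 dY1 dZ1 dX1 dY1 dZ1, pd1_form dX2 dY2 dZ2 dX2 dY2 dZ2] at c1
  rw [pd2_form dX1 dY1 dZ1 dX1 dY1 dZ1, pd2_form dX2 dY2 dZ2 dX2 dY2 dZ2] at c2
  rw [pd1_form dX1 dY1 dZ1 dX2 dY2 dZ2, pd1_const] at c3
  rw [pd2_form dX1 dY1 dZ1 dX2 dY2 dZ2, pd2_const] at c4
  simp only [cX, cY, cZ] at c2 c4
  have key := mean_curvature_algebra (p := zx z (X p, Y p)) (q := zy z (X p, Y p))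
    (r := zxx z (X p, Y p)) (s := zxy z (X p, Y p)) (t := zyy z (X p, Y p))
    (h := H (X p, Y p, Z p)) (xu := pd1 X p) (xv := pd2 X p) (yu := pd1 Y p) (yv := pd2 Y p)
    (d₁ := pd1 (pd1 X) p + pd2 (pd2 X) p) (d₂ := pd1 (pd1 Y) p + pd2 (pd2 Y) p)
    (d₃ := pd1 (pd1 Z) p + pd2 (pd2 Z) p) (hell _ hm) (hg.jac_pos p hp) (hg.conf_pos p hp)
    (by rw [← hZu]) (by rw [← hZv, hg.conf_eq p hp])
    (by rw [← hZu, ← hZv]; exact hg.conf_orth p hp)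
    (by rw [← hZu]; linear_combination c1 / 2 + c4)
    (by rw [← hZv]; linear_combination c3 - c2 / 2)
    (by rw [hZuu, hZvv]; simp only [zxx, zxy, zyy, zx, zy]; ring)
    (by rw [hpde _ hm, hg.graph p hp])
  rw [key.1, key.2.1, key.2.2, hZu, hZv]
  refine ⟨?_, ?_, ?_⟩ <;> ring

end GraphParametrization

section Uniqueness

/-- Axis-analytic functions vanishing to order `k` along the axis. -/
def AxisIdeal (k : ℕ) (f : ℝ × ℝ → ℝ) : Prop := AxisAnalytic f ∧ VanishesToOrder k f

lemma AxisIdeal.add {k : ℕ} {f g : ℝ × ℝ → ℝ} (hf : AxisIdeal k f) (hg : AxisIdeal k g) :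
    AxisIdeal k (fun p => f p + g p) := ⟨hf.1.add hg.1, hf.2.add hf.1 hg.1 hg.2⟩

lemma AxisIdeal.sub {k : ℕ} {f g : ℝ × ℝ → ℝ} (hf : AxisIdeal k f) (hg : AxisIdeal k g) :
    AxisIdeal k (fun p => f p - g p) := ⟨hf.1.sub hg.1, hf.2.sub hf.1 hg.1 hg.2⟩

lemma AxisIdeal.mul_left {k : ℕ} {f g : ℝ × ℝ → ℝ} (hg : AxisIdeal k g) (hf : AxisAnalytic f) :
    AxisIdeal k (fun p => f p * g p) := ⟨hf.mul hg.1, hg.2.mul_right hf hg.1⟩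

lemma AxisIdeal.pd1 {k : ℕ} {f : ℝ × ℝ → ℝ} (hf : AxisIdeal k f) : AxisIdeal k (pd1 f) :=
  ⟨hf.1.pd1, hf.2.pd1 hf.1⟩

lemma AxisIdeal.pd2 {k : ℕ} {f : ℝ × ℝ → ℝ} (hf : AxisIdeal (k + 1) f) : AxisIdeal k (pd2 f) :=
  ⟨hf.1.pd2, hf.2.2⟩

lemma AxisIdeal.of_succ {k : ℕ} {f : ℝ × ℝ → ℝ} (hf : AxisIdeal (k + 1) f) : AxisIdeal k f :=
  ⟨hf.1, hf.2.of_succ⟩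

/-- The right-hand side of one equation of the linearized system lies in the expected ideal. -/
lemma linearized_rhs_vanishes {k : ℕ} {V U₁ U₂ : ℝ × ℝ → ℝ} {n h a₁ a₂ b₁ b₂ c : ℝ × ℝ → ℝ}
    (hn : AxisAnalytic n) (hh : AxisAnalytic h) (ha₁ : AxisAnalytic a₁) (ha₂ : AxisAnalytic a₂)
    (hb₁ : AxisAnalytic b₁) (hb₂ : AxisAnalytic b₂) (hV : AxisIdeal (k + 1) V)
    (hU₁ : AxisIdeal (k + 1) U₁) (hU₂ : AxisIdeal (k + 1) U₂) (hc : AxisIdeal (k + 1) c)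
    (heq : ∀ u : ℝ, ∀ᶠ q in nhds ((u, 0) : ℝ × ℝ), pd2 (pd2 V) q = 2 * (c q * n q
      + h q * ((b₂ q * pd1 U₁ q + a₁ q * pd2 U₂ q) - (a₂ q * pd1 U₂ q + b₁ q * pd2 U₁ q)))
      - pd1 (pd1 V) q) : VanishesToOrder k (pd2 (pd2 V)) := by
  have h1 := ((hU₁.pd1.of_succ.mul_left hb₂).add (hU₂.pd2.mul_left ha₁)).sub
    ((hU₂.pd1.of_succ.mul_left ha₂).add (hU₁.pd2.mul_left hb₁))
  have h2 := (((hc.of_succ.mul_left hn).add (h1.mul_left hh)).mul_left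
    (AxisAnalytic.const 2)).sub hV.pd1.pd1.of_succ
  refine h2.2.congr fun u => ?_
  filter_upwards [heq u] with q hq
  rw [hq]
  ring

/-- Derivatives of a function of the form `F_u + s (G - g₀)`. -/
lemma pd_killing {F G : ℝ × ℝ → ℝ} {p : ℝ × ℝ} (s g₀ : ℝ) (hF : AnalyticAt ℝ F p)
    (hG : AnalyticAt ℝ G p) :
    pd1 (fun q => pd1 F q + s * (G q - g₀)) p = pd1 (pd1 F) p + s * pd1 G p ∧
    pd2 (fun q => pd1 F q + s * (G q - g₀)) p = pd1 (pd2 F) p + s * pd2 G p ∧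
    pd1 (pd1 fun q => pd1 F q + s * (G q - g₀)) p
      = pd1 (pd1 (pd1 F)) p + s * pd1 (pd1 G) p ∧
    pd2 (pd2 fun q => pd1 F q + s * (G q - g₀)) p
      = pd1 (pd2 (pd2 F)) p + s * pd2 (pd2 G) p := by
  have hu : ∀ {F G : ℝ × ℝ → ℝ} {p : ℝ × ℝ} (g₀ : ℝ), AnalyticAt ℝ F p → AnalyticAt ℝ G p →
      pd1 (fun q => F q + s * (G q - g₀)) p = pd1 F p + s * pd1 G p := by
    intro F G p g₀ hF hG
    have hG' := hG.differentiableAt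
    rw [pd1_add hF.differentiableAt
      ((differentiableAt_const s).fun_mul (hG'.fun_sub (differentiableAt_const g₀))),
      pd1_mul (differentiableAt_const s) (hG'.fun_sub (differentiableAt_const g₀)),
      pd1_sub hG' (differentiableAt_const g₀), pd1_const, pd1_const]
    ring
  have hv : ∀ {F G : ℝ × ℝ → ℝ} {p : ℝ × ℝ} (g₀ : ℝ), AnalyticAt ℝ F p → AnalyticAt ℝ G p →
      pd2 (fun q => F q + s * (G q - g₀)) p = pd2 F p + s * pd2 G p := by
    intro F G p g₀ hF hG
    have hG' := hG.differentiableAt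
    rw [pd2_add hF.differentiableAt
      ((differentiableAt_const s).fun_mul (hG'.fun_sub (differentiableAt_const g₀))),
      pd2_mul (differentiableAt_const s) (hG'.fun_sub (differentiableAt_const g₀)),
      pd2_sub hG' (differentiableAt_const g₀), pd2_const, pd2_const]
    ring
  have hvF : ∀ᶠ q in nhds p, pd2 (pd1 F) q = pd1 (pd2 F) q :=
    hF.eventually_analyticAt.mono fun q hq => pd2_pd1_comm hq.contDiffAt_two
  refine ⟨hu g₀ hF.pd1 hG, by rw [hv g₀ hF.pd1 hG, hvF.self_of_nhds], ?_, ?_⟩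
  · have h : pd1 (fun q => pd1 F q + s * (G q - g₀)) =ᶠ[nhds p]
        fun q => pd1 (pd1 F) q + s * (pd1 G q - 0) := by
      filter_upwards [hF.eventually_analyticAt, hG.eventually_analyticAt] with q h1 h2
      rw [hu g₀ h1.pd1 h2, sub_zero]
    rw [(pd1_congr h).eq_of_nhds, hu 0 hF.pd1.pd1 hG.pd1]
  · have h : pd2 (fun q => pd1 F q + s * (G q - g₀)) =ᶠ[nhds p]
        fun q => pd1 (pd2 F) q + s * (pd2 G q - 0) := by
      filter_upwards [hF.eventually_analyticAt, hG.eventually_analyticAt, hvF] with q h1 h2 h3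
      rw [hv g₀ h1.pd1 h2, sub_zero, h3]
    rw [(pd2_congr h).eq_of_nhds, hv 0 hF.pd2.pd1 hG.pd2, pd2_pd1_comm hF.pd2.contDiffAt_two]

/-- The `u`-derivative of an equation `ΔF = 2 h (a b - c d)`. -/
lemma pd1_mean_curvature {F h a b c d : ℝ × ℝ → ℝ} {p : ℝ × ℝ} (hF : AnalyticAt ℝ F p)
    (hh : AnalyticAt ℝ h p) (ha : AnalyticAt ℝ a p) (hb : AnalyticAt ℝ b p)
    (hc : AnalyticAt ℝ c p) (hd : AnalyticAt ℝ d p)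
    (heq : (fun q => pd1 (pd1 F) q + pd2 (pd2 F) q) =ᶠ[nhds p]
      fun q => 2 * (h q * (a q * b q - c q * d q))) :
    pd1 (pd1 (pd1 F)) p + pd1 (pd2 (pd2 F)) p
      = 2 * (pd1 h p * (a p * b p - c p * d p) + h p * ((a p * pd1 b p + b p * pd1 a p)
        - (c p * pd1 d p + d p * pd1 c p))) := by
  have h1 := (pd1_congr heq).eq_of_nhds
  have hab := ha.differentiableAt.fun_mul hb.differentiableAt
  have hcd := hc.differentiableAt.fun_mul hd.differentiableAt
  rw [pd1_add hF.pd1.pd1.differentiableAt hF.pd2.pd2.differentiableAt,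
    pd1_mul (differentiableAt_const 2) (hh.differentiableAt.fun_mul (hab.fun_sub hcd)),
    pd1_mul hh.differentiableAt (hab.fun_sub hcd), pd1_sub hab hcd,
    pd1_mul ha.differentiableAt hb.differentiableAt,
    pd1_mul hc.differentiableAt hd.differentiableAt, pd1_const] at h1
  rw [h1]
  ring

/-- A function invariant under rotations about a vertical axis is annihilated by the
corresponding Killing field. -/
lemma fderiv_rotation_field {H : R3 → ℝ} {O : Set R3} {x₀ y₀ z₀ : ℝ}
    (hHa : AnalyticOnNhd ℝ H O)
    (hrot : ∀ θ : ℝ, ∀ p ∈ O,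
      ((x₀, y₀, z₀) : R3) + rotZ θ (p - ((x₀, y₀, z₀) : R3)) ∈ O ∧
      H (((x₀, y₀, z₀) : R3) + rotZ θ (p - ((x₀, y₀, z₀) : R3))) = H p)
    {p : R3} (hp : p ∈ O) : fderiv ℝ H p (-(p.2.1 - y₀), p.1 - x₀, 0) = 0 := by
  set c : ℝ → R3 := fun θ => (x₀ + ((p.1 - x₀) * Real.cos θ - (p.2.1 - y₀) * Real.sin θ),
    y₀ + ((p.1 - x₀) * Real.sin θ + (p.2.1 - y₀) * Real.cos θ), z₀ + (p.2.2 - z₀)) with hc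
  have hc0 : c 0 = p := by
    ext <;> simp [hc]
  have hcd : HasDerivAt c (-(p.2.1 - y₀), p.1 - x₀, 0) 0 := by
    refine HasDerivAt.prodMk ?_ (HasDerivAt.prodMk ?_ ?_)
    · have := (((Real.hasDerivAt_cos 0).const_mul (p.1 - x₀)).sub
        ((Real.hasDerivAt_sin 0).const_mul (p.2.1 - y₀))).const_add x₀
      simpa using this
    · have := (((Real.hasDerivAt_sin 0).const_mul (p.1 - x₀)).add
        ((Real.hasDerivAt_cos 0).const_mul (p.2.1 - y₀))).const_add y₀
      simpa using this
    · exact hasDerivAt_const _ _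
  have hH : HasFDerivAt H (fderiv ℝ H p) (c 0) := by
    rw [hc0]
    exact (hHa p hp).differentiableAt.hasFDerivAt
  have h1 := hH.comp_hasDerivAt 0 hcd
  have h2 : H ∘ c = fun _ => H p := by
    funext θ
    exact (hrot θ p hp).2
  rw [h2] at h1
  exact h1.unique (hasDerivAt_const 0 (H p))

lemma fderiv_R3_apply (L : R3 →L[ℝ] ℝ) (a b c : ℝ) :
    L (a, b, c) = L (1, 0, 0) * a + L (0, 1, 0) * b + L (0, 0, 1) * c := by
  have h : ((a, b, c) : R3) = a • ((1, 0, 0) : R3) + b • ((0, 1, 0) : R3)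
      + c • ((0, 0, 1) : R3) := by simp
  rw [h, map_add, map_add, map_smul, map_smul, map_smul]
  simp only [smul_eq_mul]
  ring

variable {H : R3 → ℝ} {O : Set R3} {z : ℝ × ℝ → ℝ} {A : ℝ → ℝ} {x₀ y₀ z₀ ρ ε R : ℝ}
  {X Y Z : ℝ × ℝ → ℝ}

lemma IsGraphParam.axisAnalytic (hg : IsGraphParam z A x₀ y₀ z₀ ρ ε R X Y Z) :
    AxisAnalytic X ∧ AxisAnalytic Y ∧ AxisAnalytic Z := by
  have h1 : -ε < 0 := by linarith [hg.eps_pos]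
  exact ⟨fun u => hg.analytic_X (u, 0) h1 hg.R_pos, fun u => hg.analytic_Y (u, 0) h1 hg.R_pos,
    fun u => hg.analytic_Z (u, 0) h1 hg.R_pos⟩

/-- An equation `ΔF = 2 h (a b - c d)` between axis-analytic functions that holds on the strip
holds near the axis. -/
lemma equation_near_axis {F h a b c d : ℝ × ℝ → ℝ} (hR : 0 < R) (hF : AxisAnalytic F)
    (hh : AxisAnalytic h) (ha : AxisAnalytic a) (hb : AxisAnalytic b) (hc : AxisAnalytic c)
    (hd : AxisAnalytic d)
    (heq : ∀ q ∈ Strip R, pd1 (pd1 F) q + pd2 (pd2 F) q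
      = 2 * h q * (a q * b q - c q * d q)) (u : ℝ) :
    (fun q => pd1 (pd1 F) q + pd2 (pd2 F) q) =ᶠ[nhds ((u, 0) : ℝ × ℝ)]
      fun q => 2 * (h q * (a q * b q - c q * d q)) := by
  have han := ((hF.pd1.pd1.add hF.pd2.pd2).sub
    ((AxisAnalytic.const 2).mul (hh.mul ((ha.mul hb).sub (hc.mul hd))))) u
  have hlt : ∀ᶠ p in nhds ((u, 0) : ℝ × ℝ), p.2 < R :=
    continuous_snd.continuousAt.eventually (gt_mem_nhds hR)
  have h0 := han.eventually_zero_of_upper (by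
    filter_upwards [hlt] with q hq hq0
    rw [heq q ⟨hq0, hq⟩]
    ring)
  filter_upwards [h0] with q hq
  simpa [sub_eq_zero] using hq

lemma eventually_pd1_comp_rotation (hO : IsOpen O) (hHa : AnalyticOnNhd ℝ H O)
    (hrot : ∀ θ : ℝ, ∀ p ∈ O,
      ((x₀, y₀, z₀) : R3) + rotZ θ (p - ((x₀, y₀, z₀) : R3)) ∈ O ∧
      H (((x₀, y₀, z₀) : R3) + rotZ θ (p - ((x₀, y₀, z₀) : R3))) = H p)
    {p : ℝ × ℝ} (hp : (X p, Y p, Z p) ∈ O) (hX : AnalyticAt ℝ X p) (hY : AnalyticAt ℝ Y p)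
    (hZ : AnalyticAt ℝ Z p) :
    ∀ᶠ q in nhds p,
      pd1 (fun q => H (X q, Y q, Z q)) q
        = fderiv ℝ H (X q, Y q, Z q) (1, 0, 0) * pd1 X q
          + fderiv ℝ H (X q, Y q, Z q) (0, 1, 0) * pd1 Y q
          + fderiv ℝ H (X q, Y q, Z q) (0, 0, 1) * pd1 Z q ∧
      fderiv ℝ H (X q, Y q, Z q) (1, 0, 0) * -(Y q - y₀)
        + fderiv ℝ H (X q, Y q, Z q) (0, 1, 0) * (X q - x₀) = 0 := by
  have hc : ContinuousAt (fun q => ((X q, Y q, Z q) : R3)) p :=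
    hX.continuousAt.prodMk (hY.continuousAt.prodMk hZ.continuousAt)
  filter_upwards [hc.eventually (hO.mem_nhds hp), hX.eventually_analyticAt,
    hY.eventually_analyticAt, hZ.eventually_analyticAt] with q hq h1 h2 h3
  constructor
  · have hcomp := (HasFDerivAt.comp q (f := fun q => ((X q, Y q, Z q) : R3))
      (hHa _ hq).differentiableAt.hasFDerivAt
      (h1.differentiableAt.hasFDerivAt.prodMk
        (h2.differentiableAt.hasFDerivAt.prodMk h3.differentiableAt.hasFDerivAt))).fderiv
    rw [← fderiv_R3_apply]
    exact congrArg (fun L => L ((1, 0) : ℝ × ℝ)) hcomp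
  · have h := fderiv_rotation_field hHa hrot hq
    rw [fderiv_R3_apply] at h
    linear_combination h

/-- If `A` is constant, the Killing field of the rotation group, corrected by `∂_u ψ`, vanishes
near the axis. -/
lemma IsGraphParam.killing_vanishes_near_axis (hg : IsGraphParam z A x₀ y₀ z₀ ρ ε R X Y Z)
    (hz : IsEllSol H O (PDisk x₀ y₀ ρ) z) (hO : IsOpen O) (hp₀ : ((x₀, y₀, z₀) : R3) ∈ O)
    (hHa : AnalyticOnNhd ℝ H O)
    (hrot : ∀ θ : ℝ, ∀ p ∈ O,
      ((x₀, y₀, z₀) : R3) + rotZ θ (p - ((x₀, y₀, z₀) : R3)) ∈ O ∧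
      H (((x₀, y₀, z₀) : R3) + rotZ θ (p - ((x₀, y₀, z₀) : R3))) = H p)
    (hA : ∀ u u' : ℝ, A u = A u') (u : ℝ) :
    ∀ᶠ v in nhds (0 : ℝ), pd1 X (u, v) + -1 * (Y (u, v) - y₀) = 0 ∧
      pd1 Y (u, v) + 1 * (X (u, v) - x₀) = 0 ∧ pd1 Z (u, v) + 0 * (X (u, v) - x₀) = 0 := by
  obtain ⟨aX, aY, aZ⟩ := hg.axisAnalytic
  have haxis : ∀ u : ℝ, ((X (u, 0), Y (u, 0), Z (u, 0)) : R3) = (x₀, y₀, z₀) := fun u => by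
    rw [hg.axis_X, hg.axis_Y, hg.axis_Z]
  have aΨ : ∀ u : ℝ, AnalyticAt ℝ (fun q => ((X q, Y q, Z q) : R3)) (u, 0) := fun u =>
    (aX u).prod ((aY u).prod (aZ u))
  set h : ℝ × ℝ → ℝ := fun q => H (X q, Y q, Z q) with hh
  have ah : AxisAnalytic h := fun u =>
    AnalyticAt.fun_comp (f := fun q => ((X q, Y q, Z q) : R3)) (g := H)
      (hHa _ (by rw [haxis u]; exact hp₀)) (aΨ u)
  have adH : ∀ w : R3, AxisAnalytic (fun q => fderiv ℝ H (X q, Y q, Z q) w) := fun w u =>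
    ((ContinuousLinearMap.apply ℝ ℝ w).analyticAt _).comp
      (AnalyticAt.fun_comp (f := fun q => ((X q, Y q, Z q) : R3)) (g := fderiv ℝ H)
        (hHa _ (by rw [haxis u]; exact hp₀)).fderiv (aΨ u))
  set V₁ : ℝ × ℝ → ℝ := fun q => pd1 X q + -1 * (Y q - y₀) with hV₁
  set V₂ : ℝ × ℝ → ℝ := fun q => pd1 Y q + 1 * (X q - x₀) with hV₂
  set V₃ : ℝ × ℝ → ℝ := fun q => pd1 Z q + 0 * (X q - x₀) with hV₃
  have aV₁ : AxisAnalytic V₁ :=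
    aX.pd1.add ((AxisAnalytic.const _).mul (aY.sub (AxisAnalytic.const _)))
  have aV₂ : AxisAnalytic V₂ :=
    aY.pd1.add ((AxisAnalytic.const _).mul (aX.sub (AxisAnalytic.const _)))
  have aV₃ : AxisAnalytic V₃ :=
    aZ.pd1.add ((AxisAnalytic.const _).mul (aX.sub (AxisAnalytic.const _)))
  have E₁ := equation_near_axis hg.R_pos aX ah aZ.pd1 aY.pd2 aY.pd1 aZ.pd2
    fun q hq => (hg.mean_curvature hz hq).1
  have E₂ := equation_near_axis hg.R_pos aY ah aX.pd1 aZ.pd2 aZ.pd1 aX.pd2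
    fun q hq => (hg.mean_curvature hz hq).2.1
  have E₃ := equation_near_axis hg.R_pos aZ ah aX.pd1 aY.pd2 aY.pd1 aX.pd2
    fun q hq => (hg.mean_curvature hz hq).2.2
  have hev : ∀ u : ℝ, ∀ᶠ q in nhds ((u, 0) : ℝ × ℝ), _ := fun u =>
    ((E₁ u).eventually_nhds.and ((E₂ u).eventually_nhds.and ((E₃ u).eventually_nhds.and
      ((aX u).eventually_analyticAt.and ((aY u).eventually_analyticAt.and
      ((aZ u).eventually_analyticAt.and ((ah u).eventually_analyticAt.and
      (eventually_pd1_comp_rotation hO hHa hrot (by rw [haxis u]; exact hp₀)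
        (aX u) (aY u) (aZ u)))))))))
  have init₁ : ∀ u, V₁ (u, 0) = 0 ∧ pd2 V₁ (u, 0) = 0 := by
    intro u
    have h1 := hasDerivAt_fst_line (aX u).differentiableAt
    simp only [hg.axis_X] at h1
    have h2 := hasDerivAt_fst_line (aX.pd2 u).differentiableAt
    simp only [hg.pd2_X, fun s => hA s 0] at h2
    refine ⟨?_, ?_⟩
    · simp [hV₁, h1.unique (hasDerivAt_const u x₀), hg.axis_Y]
    · rw [(pd_killing (-1) y₀ (aX u) (aY u)).2.1, hg.pd2_Y,
        h2.unique ((Real.hasDerivAt_cos u).const_mul (A 0)), hA u 0]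
      ring
  have init₂ : ∀ u, V₂ (u, 0) = 0 ∧ pd2 V₂ (u, 0) = 0 := by
    intro u
    have h1 := hasDerivAt_fst_line (aY u).differentiableAt
    simp only [hg.axis_Y] at h1
    have h2 := hasDerivAt_fst_line (aY.pd2 u).differentiableAt
    simp only [hg.pd2_Y, fun s => hA s 0] at h2
    refine ⟨?_, ?_⟩
    · simp [hV₂, h1.unique (hasDerivAt_const u y₀), hg.axis_X]
    · rw [(pd_killing 1 x₀ (aY u) (aX u)).2.1, hg.pd2_X,
        h2.unique ((Real.hasDerivAt_sin u).const_mul (A 0)).fun_neg, hA u 0]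
      ring
  have init₃ : ∀ u, V₃ (u, 0) = 0 ∧ pd2 V₃ (u, 0) = 0 := by
    intro u
    have h1 := hasDerivAt_fst_line (aZ u).differentiableAt
    simp only [hg.axis_Z] at h1
    have h2 := hasDerivAt_fst_line (aZ.pd2 u).differentiableAt
    simp only [hg.pd2_Z, fun s => hA s 0] at h2
    refine ⟨?_, ?_⟩
    · simp [hV₃, h1.unique (hasDerivAt_const u z₀)]
    · rw [(pd_killing 0 x₀ (aZ u) (aX u)).2.1, h2.unique (hasDerivAt_const u (A 0))]
      ring
  have main : ∀ k : ℕ, AxisIdeal (k + 1) V₁ ∧ AxisIdeal (k + 1) V₂ ∧ AxisIdeal (k + 1) V₃ := by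
    intro k
    induction k with
    | zero =>
      exact ⟨⟨aV₁, fun u => (init₁ u).1, trivial⟩, ⟨aV₂, fun u => (init₂ u).1, trivial⟩,
        ⟨aV₃, fun u => (init₃ u).1, trivial⟩⟩
    | succ k ih =>
      obtain ⟨i₁, i₂, i₃⟩ := ih
      have ic := ((i₁.mul_left (adH (1, 0, 0))).add (i₂.mul_left (adH (0, 1, 0)))).add
        (i₃.mul_left (adH (0, 0, 1)))
      refine ⟨⟨aV₁, fun u => (init₁ u).1, fun u => (init₁ u).2, ?_⟩,
        ⟨aV₂, fun u => (init₂ u).1, fun u => (init₂ u).2, ?_⟩,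
        ⟨aV₃, fun u => (init₃ u).1, fun u => (init₃ u).2, ?_⟩⟩
      · refine linearized_rhs_vanishes ((aZ.pd1.mul aY.pd2).sub (aY.pd1.mul aZ.pd2)) ah
          aZ.pd1 aZ.pd2 aY.pd1 aY.pd2 i₁ i₃ i₂ ic fun u => ?_
        filter_upwards [hev u] with q ⟨e₁, e₂, e₃, bX, bY, bZ, bh, hu, hr⟩
        have d := pd1_mean_curvature bX bh bZ.pd1 bY.pd2 bY.pd1 bZ.pd2 e₁
        obtain ⟨-, -, k₁, k₂⟩ := pd_killing (-1) y₀ bX bY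
        obtain ⟨l₁, l₂, -⟩ := pd_killing 1 x₀ bY bX
        obtain ⟨m₁, m₂, -⟩ := pd_killing 0 x₀ bZ bX
        rw [k₁, k₂, l₁, l₂, m₁, m₂]
        simp only [hV₁, hV₂, hV₃]
        have e := e₂.self_of_nhds
        linear_combination d - e + 2 * (pd1 Z q * pd2 Y q - pd1 Y q * pd2 Z q) * (hu - hr)
      · refine linearized_rhs_vanishes ((aX.pd1.mul aZ.pd2).sub (aZ.pd1.mul aX.pd2)) ah
          aX.pd1 aX.pd2 aZ.pd1 aZ.pd2 i₂ i₁ i₃ ic fun u => ?_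
        filter_upwards [hev u] with q ⟨e₁, e₂, e₃, bX, bY, bZ, bh, hu, hr⟩
        have d := pd1_mean_curvature bY bh bX.pd1 bZ.pd2 bZ.pd1 bX.pd2 e₂
        obtain ⟨k₁, k₂, -⟩ := pd_killing (-1) y₀ bX bY
        obtain ⟨-, -, l₁, l₂⟩ := pd_killing 1 x₀ bY bX
        obtain ⟨m₁, m₂, -⟩ := pd_killing 0 x₀ bZ bX
        rw [k₁, k₂, l₁, l₂, m₁, m₂]
        simp only [hV₁, hV₂, hV₃]
        have e := e₁.self_of_nhds
        linear_combination d + e + 2 * (pd1 X q * pd2 Z q - pd1 Z q * pd2 X q) * (hu - hr)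
      · refine linearized_rhs_vanishes ((aX.pd1.mul aY.pd2).sub (aY.pd1.mul aX.pd2)) ah
          aX.pd1 aX.pd2 aY.pd1 aY.pd2 i₃ i₁ i₂ ic fun u => ?_
        filter_upwards [hev u] with q ⟨e₁, e₂, e₃, bX, bY, bZ, bh, hu, hr⟩
        have d := pd1_mean_curvature bZ bh bX.pd1 bY.pd2 bY.pd1 bX.pd2 e₃
        obtain ⟨k₁, k₂, -⟩ := pd_killing (-1) y₀ bX bY
        obtain ⟨l₁, l₂, -⟩ := pd_killing 1 x₀ bY bX
        obtain ⟨-, -, m₁, m₂⟩ := pd_killing 0 x₀ bZ bX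
        rw [k₁, k₂, l₁, l₂, m₁, m₂]
        simp only [hV₁, hV₂, hV₃]
        linear_combination d + 2 * (pd1 X q * pd2 Y q - pd1 Y q * pd2 X q) * (hu - hr)
  filter_upwards [eventually_zero_of_vanishes aV₁ (fun k => (main k).1.of_succ.2) u,
    eventually_zero_of_vanishes aV₂ (fun k => (main k).2.1.of_succ.2) u,
    eventually_zero_of_vanishes aV₃ (fun k => (main k).2.2.of_succ.2) u] with v h1 h2 h3
  exact ⟨h1, h2, h3⟩

lemma eq_zero_on_line {f : ℝ × ℝ → ℝ} {u : ℝ} (hε : 0 < ε)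
    (hf : ∀ p : ℝ × ℝ, -ε < p.2 → p.2 < R → AnalyticAt ℝ f p)
    (h0 : ∀ᶠ v in nhds (0 : ℝ), f (u, v) = 0) {v : ℝ} (hv : (u, v) ∈ Strip R) :
    f (u, v) = 0 := by
  have ha : AnalyticOnNhd ℝ (fun v => f (u, v)) (Ioo (-ε) R) := fun s hs =>
    AnalyticAt.fun_comp (f := fun v : ℝ => (u, v)) (g := f) (hf (u, s) hs.1 hs.2)
      (analyticAt_const.prod analyticAt_id)
  have hR : 0 < R := lt_trans hv.1 hv.2
  have := ha.eqOn_zero_of_preconnected_of_eventuallyEq_zero isPreconnected_Ioo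
    (show (0 : ℝ) ∈ Ioo (-ε) R from ⟨by linarith, hR⟩) h0
  exact this ⟨by linarith [hv.1], hv.2⟩

lemma exists_cos_sin_eq {c s : ℝ} (h : c ^ 2 + s ^ 2 = 1) :
    ∃ θ : ℝ, Real.cos θ = c ∧ Real.sin θ = s := by
  have hn : ‖(⟨c, s⟩ : ℂ)‖ = 1 := by
    rw [← sq_eq_sq₀ (norm_nonneg _) one_pos.le, ← Complex.normSq_eq_norm_sq, Complex.normSq_mk]
    linarith
  have h0 : (⟨c, s⟩ : ℂ) ≠ 0 := by
    intro h0
    simp [h0] at hn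
  refine ⟨Complex.arg ⟨c, s⟩, ?_, ?_⟩
  · rw [Complex.cos_arg h0, hn, div_one]
  · rw [Complex.sin_arg, hn, div_one]

/-- Two planar vectors of the same positive length differ by a rotation. -/
lemma exists_rotation {a b c d : ℝ} (h0 : 0 < a ^ 2 + b ^ 2)
    (h : a ^ 2 + b ^ 2 = c ^ 2 + d ^ 2) :
    ∃ θ : ℝ, c = a * Real.cos θ - b * Real.sin θ ∧ d = a * Real.sin θ + b * Real.cos θ := by
  obtain ⟨θ, hc, hs⟩ := exists_cos_sin_eq
    (c := (a * c + b * d) / (a ^ 2 + b ^ 2)) (s := (a * d - b * c) / (a ^ 2 + b ^ 2)) (by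
      rw [div_pow, div_pow, ← add_div, div_eq_one_iff_eq (by positivity)]
      linear_combination (-(a ^ 2 + b ^ 2)) * h)
  refine ⟨θ, ?_, ?_⟩ <;> rw [hc, hs] <;> field_simp <;> ring

/-- A rotationally equivariant graph parametrization has a radial height function. -/
lemma IsGraphParam.radial_of_killing (hg : IsGraphParam z A x₀ y₀ z₀ ρ ε R X Y Z)
    (hX : ∀ p ∈ Strip R, pd1 X p = Y p - y₀) (hY : ∀ p ∈ Strip R, pd1 Y p = -(X p - x₀))
    (hZ : ∀ p ∈ Strip R, pd1 Z p = 0) :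
    ∃ r : ℝ, 0 < r ∧ r ≤ ρ ∧ ∀ p ∈ PDisk x₀ y₀ r, ∀ q ∈ PDisk x₀ y₀ r,
      (p.1 - x₀) ^ 2 + (p.2 - y₀) ^ 2 = (q.1 - x₀) ^ 2 + (q.2 - y₀) ^ 2 → z p = z q := by
  obtain ⟨r, hr, hrρ, hsurj⟩ := hg.surj
  refine ⟨r, hr, hrρ, fun p hp q hq hpq => ?_⟩
  obtain ⟨⟨u, v⟩, huv, rfl⟩ := hsurj p hp
  have hv : ∀ s : ℝ, (s, v) ∈ Strip R := fun s => huv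
  have dX : ∀ s : ℝ, HasDerivAt (fun t => X (t, v)) (Y (s, v) - y₀) s := fun s => by
    have := hasDerivAt_fst_line (hg.analyticAt_strip (hv s)).1.differentiableAt
    rwa [hX _ (hv s)] at this
  have dY : ∀ s : ℝ, HasDerivAt (fun t => Y (t, v)) (-(X (s, v) - x₀)) s := fun s => by
    have := hasDerivAt_fst_line (hg.analyticAt_strip (hv s)).2.1.differentiableAt
    rwa [hY _ (hv s)] at this
  have dZ : ∀ s : ℝ, HasDerivAt (fun t => Z (t, v)) 0 s := fun s => by
    have := hasDerivAt_fst_line (hg.analyticAt_strip (hv s)).2.2.differentiableAt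
    rwa [hZ _ (hv s)] at this
  have cst : ∀ {f : ℝ → ℝ}, (∀ s, HasDerivAt f 0 s) → ∀ s t, f s = f t := fun hf =>
    is_const_of_deriv_eq_zero (fun s => (hf s).differentiableAt) fun s => (hf s).deriv
  have k₁ := cst (f := fun s => (X (s, v) - x₀) * Real.cos (s - u)
      - (Y (s, v) - y₀) * Real.sin (s - u)) fun s => by
    have hs : HasDerivAt (fun s => s - u) 1 s := (hasDerivAt_id s).sub_const u
    exact ((((dX s).sub_const x₀).fun_mul hs.cos).fun_sub
      (((dY s).sub_const y₀).fun_mul hs.sin)).congr_deriv (by ring)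
  have k₂ := cst (f := fun s => (X (s, v) - x₀) * Real.sin (s - u)
      + (Y (s, v) - y₀) * Real.cos (s - u)) fun s => by
    have hs : HasDerivAt (fun s => s - u) 1 s := (hasDerivAt_id s).sub_const u
    exact ((((dX s).sub_const x₀).fun_mul hs.sin).fun_add
      (((dY s).sub_const y₀).fun_mul hs.cos)).congr_deriv (by ring)
  obtain ⟨θ, hc, hd⟩ := exists_rotation hp.1 hpq
  have e₁ := k₁ (u - θ) u
  have e₂ := k₂ (u - θ) u
  simp only [sub_sub_cancel_left, sub_self, Real.cos_neg, Real.sin_neg, Real.cos_zero,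
    Real.sin_zero, mul_one, mul_zero, sub_zero, zero_add] at e₁ e₂
  have hq : (X (u - θ, v), Y (u - θ, v)) = q := by
    have := Real.sin_sq_add_cos_sq θ
    refine Prod.ext ?_ ?_
    · simp only at hc hd ⊢
      linear_combination Real.cos θ * e₁ - Real.sin θ * e₂ - hc
        - (X (u - θ, v) - x₀) * this
    · simp only at hc hd ⊢
      linear_combination Real.sin θ * e₁ + Real.cos θ * e₂ - hd
        - (Y (u - θ, v) - y₀) * this
  rw [← hq, ← hg.graph _ (hv _), ← hg.graph _ (hv _)]
  exact cst dZ _ _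

lemma IsGraphParam.radial_of_const (hg : IsGraphParam z A x₀ y₀ z₀ ρ ε R X Y Z)
    (hz : IsEllSol H O (PDisk x₀ y₀ ρ) z) (hO : IsOpen O) (hp₀ : ((x₀, y₀, z₀) : R3) ∈ O)
    (hHa : AnalyticOnNhd ℝ H O)
    (hrot : ∀ θ : ℝ, ∀ p ∈ O,
      ((x₀, y₀, z₀) : R3) + rotZ θ (p - ((x₀, y₀, z₀) : R3)) ∈ O ∧
      H (((x₀, y₀, z₀) : R3) + rotZ θ (p - ((x₀, y₀, z₀) : R3))) = H p)
    (hA : ∀ u u' : ℝ, A u = A u') :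
    ∃ r : ℝ, 0 < r ∧ r ≤ ρ ∧ ∀ p ∈ PDisk x₀ y₀ r, ∀ q ∈ PDisk x₀ y₀ r,
      (p.1 - x₀) ^ 2 + (p.2 - y₀) ^ 2 = (q.1 - x₀) ^ 2 + (q.2 - y₀) ^ 2 → z p = z q := by
  have hk := hg.killing_vanishes_near_axis hz hO hp₀ hHa hrot hA
  refine hg.radial_of_killing ?_ ?_ ?_
  · rintro ⟨u, v⟩ hp
    have := eq_zero_on_line (f := fun q => pd1 X q + -1 * (Y q - y₀)) hg.eps_pos
      (fun p h1 h2 => (hg.analytic_X p h1 h2).pd1.fun_add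
        (analyticAt_const.fun_mul ((hg.analytic_Y p h1 h2).fun_sub analyticAt_const)))
      ((hk u).mono fun _ h => h.1) hp
    linarith
  · rintro ⟨u, v⟩ hp
    have := eq_zero_on_line (f := fun q => pd1 Y q + 1 * (X q - x₀)) hg.eps_pos
      (fun p h1 h2 => (hg.analytic_Y p h1 h2).pd1.fun_add
        (analyticAt_const.fun_mul ((hg.analytic_X p h1 h2).fun_sub analyticAt_const)))
      ((hk u).mono fun _ h => h.2.1) hp
    linarith
  · rintro ⟨u, v⟩ hp
    have := eq_zero_on_line (f := fun q => pd1 Z q + 0 * (X q - x₀)) hg.eps_pos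
      (fun p h1 h2 => (hg.analytic_Z p h1 h2).pd1.fun_add
        (analyticAt_const.fun_mul ((hg.analytic_X p h1 h2).fun_sub analyticAt_const)))
      ((hk u).mono fun _ h => h.2.2) hp
    linarith

end Uniqueness

section Rigidity

variable {z : ℝ × ℝ → ℝ} {A : ℝ → ℝ} {x₀ y₀ z₀ ρ ε R : ℝ} {X Y Z : ℝ × ℝ → ℝ}

/-- The ellipticity defect `1 - z_x² - z_y²`, normalized by the squared distance to the
singularity. -/
def ellipticityRatio (z : ℝ × ℝ → ℝ) (x₀ y₀ : ℝ) (q : ℝ × ℝ) : ℝ :=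
  (1 - zx z q ^ 2 - zy z q ^ 2) / ((q.1 - x₀) ^ 2 + (q.2 - y₀) ^ 2)

lemma tendsto_div_of_eq_on_axis {f : ℝ × ℝ → ℝ} {u c : ℝ} (hf : DifferentiableAt ℝ f (u, 0))
    (h0 : f (u, 0) = c) :
    Tendsto (fun v => (f (u, v) - c) / v) (nhdsWithin 0 (Ioi 0)) (nhds (pd2 f (u, 0))) := by
  have := (hasDerivAt_snd_line hf).tendsto_slope_zero_right
  refine this.congr fun v => ?_
  rw [zero_add, h0, smul_eq_mul, div_eq_inv_mul]

lemma tendsto_pd1_div {f : ℝ × ℝ → ℝ} {u c d : ℝ} {g : ℝ → ℝ}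
    (hf : AnalyticAt ℝ f (u, 0)) (h0 : ∀ s, f (s, 0) = c) (hg : ∀ s, pd2 f (s, 0) = g s)
    (hd : HasDerivAt g d u) :
    Tendsto (fun v => pd1 f (u, v) / v) (nhdsWithin 0 (Ioi 0)) (nhds d) := by
  have h1 : pd1 f (u, 0) = 0 := by
    have := hasDerivAt_fst_line hf.differentiableAt
    simp only [h0] at this
    exact this.unique (hasDerivAt_const u c)
  have h2 : pd2 (pd1 f) (u, 0) = d := by
    rw [pd2_pd1_comm hf.contDiffAt]
    have := hasDerivAt_fst_line hf.pd2.differentiableAt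
    simp only [hg] at this
    exact this.unique hd
  simpa only [sub_zero, h2] using tendsto_div_of_eq_on_axis hf.pd1.differentiableAt h1

lemma tendsto_snd_line {f : ℝ × ℝ → ℝ} {u : ℝ} (hf : ContinuousAt f (u, 0)) :
    Tendsto (fun v => f (u, v)) (nhdsWithin 0 (Ioi 0)) (nhds (f (u, 0))) :=
  (hf.tendsto.comp (Continuous.prodMk_right u).continuousAt.tendsto).mono_left
    nhdsWithin_le_nhds

lemma eventually_mem_strip (hR : 0 < R) (u : ℝ) :
    ∀ᶠ v in nhdsWithin (0 : ℝ) (Ioi 0), (u, v) ∈ Strip R :=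
  Filter.mem_of_superset (Ioo_mem_nhdsGT hR) fun _ hv => hv

lemma IsGraphParam.ellipticityRatio_eq (hg : IsGraphParam z A x₀ y₀ z₀ ρ ε R X Y Z)
    (hz : ContDiffOn ℝ 2 z (PDisk x₀ y₀ ρ)) {p : ℝ × ℝ} (hp : p ∈ Strip R) :
    ellipticityRatio z x₀ y₀ (X p, Y p)
      = ((pd1 X p / p.2) ^ 2 + (pd1 Y p / p.2) ^ 2 - (pd1 Z p / p.2) ^ 2) ^ 2
        / ((pd1 X p / p.2 * pd2 Y p - pd2 X p * (pd1 Y p / p.2)) ^ 2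
          * (((X p - x₀) / p.2) ^ 2 + ((Y p - y₀) / p.2) ^ 2)) := by
  obtain ⟨hu, hv⟩ := hg.pd_Z hz hp
  have e₁ := hg.conf_eq p hp
  have e₂ := hg.conf_orth p hp
  have hJ := hg.jac_pos p hp
  have hr := (hg.mem p hp).1
  have hp2 : p.2 ≠ 0 := hp.1.ne'
  have key : (pd1 X p ^ 2 + pd1 Y p ^ 2 - pd1 Z p ^ 2) ^ 2
      = (1 - zx z (X p, Y p) ^ 2 - zy z (X p, Y p) ^ 2)
        * (pd1 X p * pd2 Y p - pd2 X p * pd1 Y p) ^ 2 := by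
    have hdet : (1 - zx z (X p, Y p) ^ 2 - zy z (X p, Y p) ^ 2)
        * (pd1 X p * pd2 Y p - pd2 X p * pd1 Y p) ^ 2
        = (pd1 X p * pd1 X p + pd1 Y p * pd1 Y p - pd1 Z p * pd1 Z p)
          * (pd2 X p * pd2 X p + pd2 Y p * pd2 Y p - pd2 Z p * pd2 Z p)
          - (pd1 X p * pd2 X p + pd1 Y p * pd2 Y p - pd1 Z p * pd2 Z p) ^ 2 := by
      rw [hu, hv]; ring
    rw [hdet, ← e₁, e₂]
    ring
  simp only at hr
  have hJ' : (pd1 X p / p.2 * pd2 Y p - pd2 X p * (pd1 Y p / p.2))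
      = (pd1 X p * pd2 Y p - pd2 X p * pd1 Y p) / p.2 := by ring
  have hr' : ((X p - x₀) / p.2) ^ 2 + ((Y p - y₀) / p.2) ^ 2
      = ((X p - x₀) ^ 2 + (Y p - y₀) ^ 2) / p.2 ^ 2 := by ring
  have hl' : (pd1 X p / p.2) ^ 2 + (pd1 Y p / p.2) ^ 2 - (pd1 Z p / p.2) ^ 2
      = (pd1 X p ^ 2 + pd1 Y p ^ 2 - pd1 Z p ^ 2) / p.2 ^ 2 := by ring
  rw [hJ', hr', hl', div_pow, key, ellipticityRatio, div_pow]
  simp only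
  rw [div_mul_div_comm, div_div_eq_mul_div, div_mul_eq_mul_div, div_div,
    div_eq_div_iff hr.ne' (by positivity)]
  ring

lemma IsGraphParam.tendsto_ellipticityRatio (hg : IsGraphParam z A x₀ y₀ z₀ ρ ε R X Y Z)
    (hz : ContDiffOn ℝ 2 z (PDisk x₀ y₀ ρ)) (hA : MemA2 A) (u : ℝ) :
    Tendsto (fun v => ellipticityRatio z x₀ y₀ (X (u, v), Y (u, v)))
      (nhdsWithin 0 (Ioi 0)) (nhds (1 / A u ^ 2)) := by
  have hε : -ε < (0 : ℝ) := by linarith [hg.eps_pos]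
  have aX := hg.analytic_X (u, 0) hε hg.R_pos
  have aY := hg.analytic_Y (u, 0) hε hg.R_pos
  have aZ := hg.analytic_Z (u, 0) hε hg.R_pos
  have hd : HasDerivAt A (deriv A u) u := (hA.1 u (mem_univ u)).differentiableAt.hasDerivAt
  have hA0 := hA.2.2 u
  have tXu := tendsto_pd1_div aX hg.axis_X hg.pd2_X (hd.fun_mul (Real.hasDerivAt_cos u))
  have tYu := tendsto_pd1_div aY hg.axis_Y hg.pd2_Y (hd.fun_mul (Real.hasDerivAt_sin u)).fun_neg
  have tZu := tendsto_pd1_div aZ hg.axis_Z hg.pd2_Z hd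
  have tX := tendsto_div_of_eq_on_axis aX.differentiableAt (hg.axis_X u)
  have tY := tendsto_div_of_eq_on_axis aY.differentiableAt (hg.axis_Y u)
  have tXv := tendsto_snd_line aX.pd2.continuousAt
  have tYv := tendsto_snd_line aY.pd2.continuousAt
  rw [hg.pd2_X] at tX tXv
  rw [hg.pd2_Y] at tY tYv
  have hcs := Real.sin_sq_add_cos_sq u
  have eJ : (deriv A u * Real.cos u + A u * -Real.sin u) * -(A u * Real.sin u)
      - A u * Real.cos u * -(deriv A u * Real.sin u + A u * Real.cos u) = A u ^ 2 := by
    linear_combination A u ^ 2 * hcs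
  have er : (A u * Real.cos u) ^ 2 + (-(A u * Real.sin u)) ^ 2 = A u ^ 2 := by
    linear_combination A u ^ 2 * hcs
  have el : (deriv A u * Real.cos u + A u * -Real.sin u) ^ 2
      + (-(deriv A u * Real.sin u + A u * Real.cos u)) ^ 2 - deriv A u ^ 2 = A u ^ 2 := by
    linear_combination (A u ^ 2 + deriv A u ^ 2) * hcs
  have tJ := (tXu.mul tYv).sub (tXv.mul tYu)
  have tr := (tX.pow 2).add (tY.pow 2)
  have tl := ((tXu.pow 2).add (tYu.pow 2)).sub (tZu.pow 2)
  rw [eJ] at tJ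
  rw [er] at tr
  rw [el] at tl
  have := (tl.pow 2).div ((tJ.pow 2).mul tr) (by positivity)
  have hlim : (A u ^ 2) ^ 2 / ((A u ^ 2) ^ 2 * A u ^ 2) = 1 / A u ^ 2 := by
    field_simp
  rw [hlim] at this
  refine this.congr' ?_
  filter_upwards [eventually_mem_strip hg.R_pos u] with v hv
  exact (hg.ellipticityRatio_eq hz hv).symm

/-- The squared gradient of a radial function is radial. -/
lemma gradient_sq_radial {r : ℝ} (hz : ContDiffOn ℝ 2 z (PDisk x₀ y₀ r))
    (hrad : ∀ p ∈ PDisk x₀ y₀ r, ∀ q ∈ PDisk x₀ y₀ r,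
      (p.1 - x₀) ^ 2 + (p.2 - y₀) ^ 2 = (q.1 - x₀) ^ 2 + (q.2 - y₀) ^ 2 → z p = z q)
    {p q : ℝ × ℝ} (hp : p ∈ PDisk x₀ y₀ r) (hq : q ∈ PDisk x₀ y₀ r)
    (hpq : (p.1 - x₀) ^ 2 + (p.2 - y₀) ^ 2 = (q.1 - x₀) ^ 2 + (q.2 - y₀) ^ 2) :
    zx z p ^ 2 + zy z p ^ 2 = zx z q ^ 2 + zy z q ^ 2 := by
  obtain ⟨θ, h₁, h₂⟩ := exists_rotation hp.1 hpq
  have hcs := Real.sin_sq_add_cos_sq θ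
  let a : ℝ × ℝ → ℝ := fun w => x₀ + ((w.1 - x₀) * Real.cos θ - (w.2 - y₀) * Real.sin θ)
  let b : ℝ × ℝ → ℝ := fun w => y₀ + ((w.1 - x₀) * Real.sin θ + (w.2 - y₀) * Real.cos θ)
  have hab : (a p, b p) = q := Prod.ext (by simp only [a]; linarith) (by simp only [b]; linarith)
  have hrot : ∀ w, (a w - x₀) ^ 2 + (b w - y₀) ^ 2 = (w.1 - x₀) ^ 2 + (w.2 - y₀) ^ 2 := by
    intro w
    simp only [a, b]
    linear_combination ((w.1 - x₀) ^ 2 + (w.2 - y₀) ^ 2) * hcs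
  have heq : z =ᶠ[nhds p] fun w => z (a w, b w) := by
    filter_upwards [(isOpen_pDisk x₀ y₀ r).mem_nhds hp] with w hw
    refine hrad w hw _ ?_ (hrot w).symm
    simpa only [PDisk, mem_ofPred_eq, hrot w] using hw
  have hzq : DifferentiableAt ℝ z (a p, b p) := by
    rw [hab]
    exact (hz.contDiffAt ((isOpen_pDisk _ _ _).mem_nhds hq)).differentiableAt (by norm_num)
  have hda : DifferentiableAt ℝ a p := by fun_prop
  have hdb : DifferentiableAt ℝ b p := by fun_prop
  have lin : ∀ c d e s : ℝ, HasDerivAt (fun t : ℝ => c + ((t - d) * e)) e s := fun c d e s => by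
    simpa using (((hasDerivAt_id' s).sub_const d).mul_const e).const_add c
  have d1a : pd1 a p = Real.cos θ := by
    refine (hasDerivAt_fst_line (v := p.2) hda).unique ?_
    refine (lin (x₀ - (p.2 - y₀) * Real.sin θ) x₀ (Real.cos θ) p.1).congr_of_eventuallyEq
      (Eventually.of_forall fun s => ?_)
    simp only [a]
    ring
  have d1b : pd1 b p = Real.sin θ := by
    refine (hasDerivAt_fst_line (v := p.2) hdb).unique ?_
    refine (lin (y₀ + (p.2 - y₀) * Real.cos θ) x₀ (Real.sin θ) p.1).congr_of_eventuallyEq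
      (Eventually.of_forall fun s => ?_)
    simp only [b]
    ring
  have d2a : pd2 a p = -Real.sin θ := by
    refine (hasDerivAt_snd_line (u := p.1) hda).unique ?_
    refine (lin (x₀ + (p.1 - x₀) * Real.cos θ) y₀ (-Real.sin θ) p.2).congr_of_eventuallyEq
      (Eventually.of_forall fun s => ?_)
    simp only [a]
    ring
  have d2b : pd2 b p = Real.cos θ := by
    refine (hasDerivAt_snd_line (u := p.1) hdb).unique ?_
    refine (lin (y₀ + (p.1 - x₀) * Real.sin θ) y₀ (Real.cos θ) p.2).congr_of_eventuallyEq
      (Eventually.of_forall fun s => ?_)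
    simp only [b]
    ring
  obtain ⟨k₁, k₂⟩ := pd_comp₂ hzq hda hdb
  rw [d1a, d1b, hab] at k₁
  rw [d2a, d2b, hab] at k₂
  have f₁ : zx z p = zx z q * Real.cos θ + zy z q * Real.sin θ := by
    rw [zx, zy, ← k₁, pd1, pd1, heq.fderiv_eq]
  have f₂ : zy z p = zx z q * -Real.sin θ + zy z q * Real.cos θ := by
    rw [zx, zy, ← k₂, pd2, pd2, heq.fderiv_eq]
  rw [f₁, f₂]
  linear_combination (zx z q ^ 2 + zy z q ^ 2) * hcs

lemma IsGraphParam.continuousOn_radius_sq (hg : IsGraphParam z A x₀ y₀ z₀ ρ ε R X Y Z) (u : ℝ) :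
    ContinuousOn (fun v => (X (u, v) - x₀) ^ 2 + (Y (u, v) - y₀) ^ 2) (Ico 0 R) := by
  intro v hv
  have h : -ε < v := by linarith [hv.1, hg.eps_pos]
  have hX := (hasDerivAt_snd_line (hg.analytic_X (u, v) h hv.2).differentiableAt).continuousAt
  have hY := (hasDerivAt_snd_line (hg.analytic_Y (u, v) h hv.2).differentiableAt).continuousAt
  exact (((hX.fun_sub continuousAt_const).fun_pow 2).fun_add
    ((hY.fun_sub continuousAt_const).fun_pow 2)).continuousWithinAt

/-- Every small radius is attained along each coordinate line. -/
lemma IsGraphParam.exists_radius_sq_eq (hg : IsGraphParam z A x₀ y₀ z₀ ρ ε R X Y Z) (u : ℝ)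
    {δ m : ℝ} (hδ : 0 < δ) (hδR : δ < R) (hm : 0 < m)
    (hle : m ≤ (X (u, δ) - x₀) ^ 2 + (Y (u, δ) - y₀) ^ 2) :
    ∃ v, 0 < v ∧ v ≤ δ ∧ (X (u, v) - x₀) ^ 2 + (Y (u, v) - y₀) ^ 2 = m := by
  have hc := (hg.continuousOn_radius_sq u).mono (t := Icc 0 δ)
    fun _ h => ⟨h.1, h.2.trans_lt hδR⟩
  obtain ⟨v, hv, hvm⟩ := intermediate_value_Icc hδ.le hc (show m ∈ Icc _ _ from
    ⟨by simpa [hg.axis_X, hg.axis_Y] using hm.le, hle⟩)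
  refine ⟨v, lt_of_le_of_ne hv.1 ?_, hv.2, hvm⟩
  rintro rfl
  simp only [hg.axis_X, hg.axis_Y, sub_self] at hvm
  norm_num at hvm
  exact hm.ne hvm

lemma IsGraphParam.eventually_mem_pDisk (hg : IsGraphParam z A x₀ y₀ z₀ ρ ε R X Y Z) {r : ℝ}
    (hr : 0 < r) (u : ℝ) :
    ∀ᶠ v in nhdsWithin (0 : ℝ) (Ioi 0), (X (u, v), Y (u, v)) ∈ PDisk x₀ y₀ r := by
  have hc : ContinuousWithinAt (fun v => (X (u, v) - x₀) ^ 2 + (Y (u, v) - y₀) ^ 2) (Ioi 0) 0 :=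
    (hg.continuousOn_radius_sq u 0 ⟨le_rfl, hg.R_pos⟩).mono_of_mem_nhdsWithin
      (Ico_mem_nhdsGT hg.R_pos)
  have h0 : (X (u, 0) - x₀) ^ 2 + (Y (u, 0) - y₀) ^ 2 < r ^ 2 := by
    simpa [hg.axis_X, hg.axis_Y] using pow_pos hr 2
  have hlt := hc.tendsto.eventually_lt_const h0
  filter_upwards [eventually_mem_strip hg.R_pos u, hlt] with v hv hv'
  exact ⟨(hg.mem _ hv).1, hv'⟩

lemma IsGraphParam.const_sq_of_radial (hg : IsGraphParam z A x₀ y₀ z₀ ρ ε R X Y Z)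
    (hz : ContDiffOn ℝ 2 z (PDisk x₀ y₀ ρ)) (hA : MemA2 A) {r : ℝ} (hr : 0 < r) (hrρ : r ≤ ρ)
    (hrad : ∀ p ∈ PDisk x₀ y₀ r, ∀ q ∈ PDisk x₀ y₀ r,
      (p.1 - x₀) ^ 2 + (p.2 - y₀) ^ 2 = (q.1 - x₀) ^ 2 + (q.2 - y₀) ^ 2 → z p = z q)
    (u u' : ℝ) : A u ^ 2 = A u' ^ 2 := by
  by_contra hne
  have hne' : 1 / A u ^ 2 ≠ 1 / A u' ^ 2 := fun h => hne (by simpa using h)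
  obtain ⟨U, U', hU, hU', hdisj⟩ := t2_separation_nhds hne'
  have hall := ((hg.tendsto_ellipticityRatio hz hA u).eventually hU).and
    (((hg.tendsto_ellipticityRatio hz hA u').eventually hU').and
    ((hg.eventually_mem_pDisk hr u).and ((hg.eventually_mem_pDisk hr u').and
      (eventually_mem_strip hg.R_pos 0))))
  obtain ⟨δ₀, hδ₀, hδ⟩ := mem_nhdsGT_iff_exists_Ioc_subset.1 hall
  rw [mem_Ioi] at hδ₀
  obtain ⟨-, -, h₃, h₄, h₅⟩ := hδ ⟨hδ₀, le_rfl⟩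
  obtain ⟨v, hv0, hv, hm⟩ := hg.exists_radius_sq_eq u hδ₀ h₅.2 (lt_min h₃.1 h₄.1)
    (min_le_left _ _)
  obtain ⟨v', hv0', hv', hm'⟩ := hg.exists_radius_sq_eq u' hδ₀ h₅.2 (lt_min h₃.1 h₄.1)
    (min_le_right _ _)
  obtain ⟨k₁, -, k₃, -⟩ := hδ ⟨hv0, hv⟩
  obtain ⟨-, k₂, -, k₄, -⟩ := hδ ⟨hv0', hv'⟩
  have hsub : PDisk x₀ y₀ r ⊆ PDisk x₀ y₀ ρ := fun p hp =>
    ⟨hp.1, hp.2.trans_le (pow_le_pow_left₀ hr.le hrρ 2)⟩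
  have hgrad := gradient_sq_radial (hz.mono hsub) hrad k₃ k₄ (hm.trans hm'.symm)
  refine disjoint_left.1 hdisj k₁ ?_
  have : ellipticityRatio z x₀ y₀ (X (u, v), Y (u, v))
      = ellipticityRatio z x₀ y₀ (X (u', v'), Y (u', v')) := by
    simp only [ellipticityRatio, hm, hm', sub_sub, hgrad]
  rw [this]
  exact k₂

lemma MemA2.eq_of_sq_eq (hA : MemA2 A) (h : ∀ u u' : ℝ, A u ^ 2 = A u' ^ 2) (u u' : ℝ) :
    A u = A u' := by
  have hc : Continuous A := continuousOn_univ.1 hA.1.continuousOn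
  refine isPreconnected_univ.eq_of_sq_eq (f := A) (g := fun _ => A u') hc.continuousOn
    continuousOn_const (fun w _ => ?_) (fun _ => hA.2.2 u') (mem_univ u') rfl (mem_univ u)
  exact h w u'

end Rigidity

/-- Corollary `radial`: for `ℋ` rotationally symmetric around the
vertical line through `p₀`, a solution `z ∈ 𝒜₁` corresponding to `A ∈ 𝒜₂` is radially
symmetric near the singularity if and only if `A` is constant. -/
theorem stmt10 (O : Set R3) (x₀ y₀ z₀ ρ : ℝ) (H : R3 → ℝ) (z : ℝ × ℝ → ℝ) (A : ℝ → ℝ)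
    (hO : IsOpen O) (hp₀ : ((x₀, y₀, z₀) : R3) ∈ O)
    (hHa : AnalyticOnNhd ℝ H O) (hHpos : ∀ p ∈ O, 0 < H p)
    (hrot : ∀ θ : ℝ, ∀ p ∈ O,
      ((x₀, y₀, z₀) : R3) + rotZ θ (p - ((x₀, y₀, z₀) : R3)) ∈ O ∧
      H (((x₀, y₀, z₀) : R3) + rotZ θ (p - ((x₀, y₀, z₀) : R3))) = H p)
    (hz : MemA1 H O x₀ y₀ z₀ ρ z) (hA : MemA2 A)
    (hc : Corr z x₀ y₀ z₀ ρ A) :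
    (∃ ε : ℝ, 0 < ε ∧ ε ≤ ρ ∧ ∀ p ∈ PDisk x₀ y₀ ε, ∀ q ∈ PDisk x₀ y₀ ε,
      (p.1 - x₀) ^ 2 + (p.2 - y₀) ^ 2 = (q.1 - x₀) ^ 2 + (q.2 - y₀) ^ 2 → z p = z q)
    ↔ (∀ u u' : ℝ, A u = A u') := by
  obtain ⟨hρ, hell, -, -⟩ := hz
  obtain ⟨ε, R, X, Y, Z, hg⟩ := hc.exists_isGraphParam hρ
  refine ⟨?_, hg.radial_of_const hell hO hp₀ hHa hrot⟩
  rintro ⟨r, hr, hrρ, hrad⟩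
  exact hA.eq_of_sq_eq (hg.const_sq_of_radial hell.1 hA hr hrρ hrad)
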